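/- arXiv:2208.07519 — 14 statements merged into one kernel-verified Lean document; each statement's English description precedes it below -/
import Mathlib

section
/- Let A → B be an injective integral ring homomorphism between integral domains, with A a normal domain, and let π ∈ A. Then: (i) a prime ideal q of B has height 1 and contains the image of π if and only if its contraction q ∩ A has height 1 and contains π (i.e. the inverse image of S_π(A) under Spec(B) → Spec(A) is exactly S_π(B)); and (ii) the induced map S_π(B) → S_π(A) is surjective. -/
/-- Over a normal domain, contraction along an integral injective map into a domain preserves the
height of primes: incomparability makes the contraction strictly monotone, and going-down lets
one lift chains. -/
theorem PrimeSpectrum.height_comap_of_isIntegral {A B : Type*} [CommRing A] [CommRing B]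
    [IsDomain B] [IsIntegrallyClosed A] (f : A →+* B) (hinj : Function.Injective f)
    (hint : f.IsIntegral) (q : PrimeSpectrum B) :
    Order.height (PrimeSpectrum.comap f q) = Order.height q := by
  algebraize [f]
  have : FaithfulSMul A B := (faithfulSMul_iff_algebraMap_injective A B).mpr hinj
  refine (Order.height_eq_of_strictMono (PrimeSpectrum.comap f)
    (fun _ _ h ↦ Ideal.IsIntegral.comap_lt_comap (R := A) h) (fun Q p hp ↦ ?_) q).symm
  have : Q.asIdeal.LiesOver (PrimeSpectrum.comap f Q).asIdeal := ⟨rfl⟩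
  obtain ⟨P, hPQ, hP, hPp⟩ := Ideal.exists_ideal_lt_liesOver_of_lt Q.asIdeal
    (p := p.asIdeal) (q := (PrimeSpectrum.comap f Q).asIdeal) hp
  exact ⟨⟨P, hP⟩, hPQ, PrimeSpectrum.ext hPp.over.symm⟩


/-- Let `A → B` be an injective integral ring homomorphism between integral
domains, with `A` a normal domain (integrally closed in its fraction field), and let `π ∈ A`.
Then (i) a prime ideal `q` of `B` has height `1` and contains the image of `π` if and only if its
contraction `q ∩ A` has height `1` and contains `π`, and (ii) the induced map
`S_π(B) → S_π(A)` on sets of height-one primes containing `π` is surjective. -/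
theorem statement0 {A B : Type*} [CommRing A] [CommRing B] [IsDomain A] [IsDomain B]
    [IsIntegrallyClosed A] (f : A →+* B) (hinj : Function.Injective f)
    (hint : f.IsIntegral) (π : A) :
    (∀ (q : Ideal B) (hq : q.IsPrime),
      (Order.height (⟨q, hq⟩ : PrimeSpectrum B) = 1 ∧ f π ∈ q) ↔
        (Order.height (PrimeSpectrum.comap f ⟨q, hq⟩) = 1 ∧ π ∈ q.comap f)) ∧
    (∀ (p : Ideal A) (hp : p.IsPrime),
      Order.height (⟨p, hp⟩ : PrimeSpectrum A) = 1 → π ∈ p →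
      ∃ (q : Ideal B) (hq : q.IsPrime),
        Order.height (⟨q, hq⟩ : PrimeSpectrum B) = 1 ∧ f π ∈ q ∧ q.comap f = p) := by
  refine ⟨fun q hq ↦ ?_, fun p hp hp1 hπ ↦ ?_⟩
  · rw [PrimeSpectrum.height_comap_of_isIntegral f hinj hint, Ideal.mem_comap]
  · obtain ⟨q, hqp⟩ := hint.comap_surjective hinj ⟨p, hp⟩
    have hq : q.asIdeal.comap f = p := congrArg PrimeSpectrum.asIdeal hqp
    refine ⟨q.asIdeal, q.isPrime, ?_, ?_, hq⟩
    · exact (PrimeSpectrum.height_comap_of_isIntegral f hinj hint q).symm.trans (hqp ▸ hp1)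
    · exact Ideal.mem_comap.mp (hq ▸ hπ)
end

section
/- Let A → B be an injective integral ring homomorphism of normal domains with A Noetherian, and let π be a nonzero element of A. Assume that B is the union of a directed family of A-subalgebras, each of which is a Noetherian normal domain. Then for every height-1 prime ideal q of B containing the image of π, the localization B_q of B at q is a valuation ring. -/
/-- The localization of a Noetherian normal domain at a prime ideal containing no smaller nonzero
prime ideal is a valuation ring. -/
theorem valuationRing_localization_atPrime_of_forall_lt {R : Type*} [CommRing R] [IsDomain R]
    [IsIntegrallyClosed R] [IsNoetherianRing R] (p : Ideal R) [p.IsPrime]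
    (hp : ∀ p' : Ideal R, p'.IsPrime → p' < p → p' = ⊥) :
    ValuationRing (Localization.AtPrime p) := by
  have : IsNoetherianRing (Localization.AtPrime p) :=
    IsLocalization.isNoetherianRing p.primeCompl _ inferInstance
  have htfae : (IsIntegrallyClosed (Localization.AtPrime p) ∧
      ∀ P : Ideal (Localization.AtPrime p), P ≠ ⊥ → P.IsPrime →
        P = IsLocalRing.maximalIdeal (Localization.AtPrime p)) ↔
      ValuationRing (Localization.AtPrime p) :=
    (tfae_of_isNoetherianRing_of_isLocalRing_of_isDomain (Localization.AtPrime p)).out 3 1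
  refine htfae.mp ⟨isIntegrallyClosed_of_isLocalization _ p.primeCompl
      p.primeCompl_le_nonZeroDivisors, fun P hP0 hP ↦ ?_⟩
  have hmap := IsLocalization.map_under p.primeCompl (Localization.AtPrime p) P
  have hle : P.under R ≤ p :=
    (Ideal.comap_mono (IsLocalRing.le_maximalIdeal_of_isPrime P)).trans_eq
      Localization.AtPrime.under_maximalIdeal
  rcases hle.lt_or_eq with h | h
  · rw [hp _ inferInstance h, Ideal.map_bot] at hmap
    exact absurd hmap.symm hP0
  · rw [← hmap, h, Localization.AtPrime.map_eq_maximalIdeal]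

/-- Under an integral extension of domains with normal base, a prime ideal lying under a prime of
height one contains no smaller nonzero prime ideal. -/
theorem Ideal.eq_bot_of_lt_under_of_height_eq_one {R S : Type*} [CommRing R] [CommRing S]
    [IsDomain S] [IsIntegrallyClosed R] [Algebra R S] [FaithfulSMul R S]
    [Algebra.IsIntegral R S] (q : Ideal S) (hq : q.IsPrime)
    (hht : Order.height (⟨q, hq⟩ : PrimeSpectrum S) = 1)
    (p : Ideal R) (hp : p.IsPrime) (hlt : p < q.under R) : p = ⊥ := by
  obtain ⟨Q, hQq, hQ, hQp⟩ := Ideal.exists_ideal_lt_liesOver_of_lt q hlt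
  have hlt' : (⟨Q, hQ⟩ : PrimeSpectrum S) < ⟨q, hq⟩ := hQq
  have h0 : Order.height (⟨Q, hQ⟩ : PrimeSpectrum S) = 0 := by
    have h := Order.height_add_one_le hlt'
    rw [hht] at h
    exact nonpos_iff_eq_zero.mp ((ENat.add_le_add_iff_right ENat.one_ne_top).mp (by simpa using h))
  have hQ0 : Q = ⊥ := by
    have hmin := Order.height_eq_zero.mp h0
    exact le_bot_iff.mp
      (hmin (show (⟨⊥, Ideal.isPrime_bot⟩ : PrimeSpectrum S) ≤ ⟨Q, hQ⟩ from bot_le (a := Q)))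
  rw [hQp.over, hQ0]
  exact Ideal.comap_bot_of_injective _ (FaithfulSMul.algebraMap_injective R S)

/-- If any two elements of a domain come from a ring whose localization at the preimage of the
prime ideal `q` is a valuation ring, then the localization at `q` is a valuation ring. -/
theorem valuationRing_localization_atPrime_of_forall_exists_subalgebra {A B : Type*} [CommRing A]
    [CommRing B] [IsDomain B] [Algebra A B] (q : Ideal B) [q.IsPrime]
    (h : ∀ b c : B, ∃ S : Subalgebra A B, b ∈ S ∧ c ∈ S ∧
      ValuationRing (Localization.AtPrime (q.under S))) :
    ValuationRing (Localization.AtPrime q) := by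
  refine ValuationRing.iff_dvd_total.mpr ⟨fun x y ↦ ?_⟩
  obtain ⟨b, s, rfl⟩ := IsLocalization.exists_mk'_eq q.primeCompl x
  obtain ⟨c, t, rfl⟩ := IsLocalization.exists_mk'_eq q.primeCompl y
  have hassoc (b : B) (s : q.primeCompl) :
      Associated (algebraMap B (Localization.AtPrime q) b) (IsLocalization.mk' _ b s) :=
    Associated.symm ⟨(IsLocalization.map_units (Localization.AtPrime q) s).unit,
      IsLocalization.mk'_spec _ b s⟩
  rw [← (hassoc b s).dvd_iff_dvd_left, ← (hassoc c t).dvd_iff_dvd_right,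
    ← (hassoc c t).dvd_iff_dvd_left, ← (hassoc b s).dvd_iff_dvd_right]
  obtain ⟨S, hb, hc, hS⟩ := h b c
  let f := Localization.localRingHom (q.under S) q (algebraMap S B) rfl
  have hf (z : S) : f (algebraMap S _ z) = algebraMap B (Localization.AtPrime q) z :=
    Localization.localRingHom_to_map _ _ _ rfl z
  rw [← hf ⟨b, hb⟩, ← hf ⟨c, hc⟩]
  exact (ValuationRing.dvd_total _ _).imp (map_dvd f) (map_dvd f)


/-- Let `A → B` be an injective integral ring homomorphism of normal domains
with `A` Noetherian, and let `π` be a nonzero element of `A`. Assume that `B` is the union of a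
directed family of `A`-subalgebras, each of which is a Noetherian normal domain. Then for every
height-one prime ideal `q` of `B` containing the image of `π`, the localization `B_q` is a
valuation ring. -/
theorem statement1 {A B : Type*} [CommRing A] [CommRing B] [IsDomain A] [IsDomain B]
    [IsIntegrallyClosed A] [IsIntegrallyClosed B] [IsNoetherianRing A]
    [Algebra A B] (hinj : Function.Injective (algebraMap A B))
    [Algebra.IsIntegral A B] {π : A} (hπ : π ≠ 0)
    {ι : Type*} (F : ι → Subalgebra A B) (hdir : Directed (· ≤ ·) F)
    (hcover : ∀ b : B, ∃ i, b ∈ F i)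
    (hnoeth : ∀ i, IsNoetherianRing (F i)) (hnorm : ∀ i, IsIntegrallyClosed (F i))
    (q : Ideal B) (hq : q.IsPrime)
    (hht : Order.height (⟨q, hq⟩ : PrimeSpectrum B) = 1)
    (hπq : algebraMap A B π ∈ q) :
    ValuationRing (Localization.AtPrime q) := by
  refine valuationRing_localization_atPrime_of_forall_exists_subalgebra (A := A) q fun b c ↦ ?_
  obtain ⟨i, hb⟩ := hcover b
  obtain ⟨j, hc⟩ := hcover c
  obtain ⟨k, hik, hjk⟩ := hdir i j
  have := hnoeth k
  have := hnorm k
  have : Algebra.IsIntegral (F k) B := Algebra.IsIntegral.tower_top A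
  exact ⟨F k, hik hb, hjk hc, valuationRing_localization_atPrime_of_forall_lt _
    (q.eq_bot_of_lt_under_of_height_eq_one hq hht)⟩
end

section
/- Let A → B be an injective integral ring homomorphism of normal domains with A Noetherian, and let π be a nonzero element of A. Assume that B is the union of a directed family of A-subalgebras, each of which is a Noetherian normal domain. Then for every integer n > 0 and every b ∈ B, if the image of b in the localization B_q lies in π^n·B_q for every height-1 prime ideal q of B containing π, then b ∈ π^n·B. Equivalently, the natural map B/π^nB → ∏_{q ∈ S_π(B)} B_q/π^nB_q is injective. -/
/-- If `x ∤ b` in a Noetherian ring, some multiple of `b` has a prime annihilator modulo `x`. -/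
lemma exists_isPrime_mem_iff_dvd_mul {R : Type*} [CommRing R] [IsNoetherianRing R] {x b : R}
    (h : ¬ x ∣ b) :
    ∃ (p : Ideal R) (c : R), p.IsPrime ∧ ¬ x ∣ c * b ∧ ∀ r, r ∈ p ↔ x ∣ r * (c * b) := by
  let I : R → Ideal R := fun c ↦ (Ideal.span {x}).colon {c * b}
  have hI (c r : R) : r ∈ I c ↔ x ∣ r * (c * b) := by
    simp [I, Submodule.mem_colon_singleton, Ideal.mem_span_singleton]
  obtain ⟨_, ⟨c, hc, rfl⟩, hmax⟩ := set_has_maximal_iff_noetherian.mpr ‹IsNoetherianRing R›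
    (I '' {c | ¬ x ∣ c * b}) ⟨I 1, 1, by simpa using h, rfl⟩
  refine ⟨I c, c, ⟨fun htop ↦ hc ?_, fun {r s} hrs ↦ ?_⟩, hc, hI c⟩
  · simpa [hI] using (Ideal.eq_top_iff_one _).mp htop
  · by_contra! hn
    have hle : I c ≤ I (s * c) := fun t ht ↦ by
      rw [hI] at ht ⊢
      exact (ht.mul_left s).trans (dvd_of_eq (by ring))
    refine hmax _ ⟨s * c, fun hs ↦ hn.2 ?_, rfl⟩ (lt_of_le_of_ne hle fun he ↦ hn.1 ?_)
    · rw [hI, ← mul_assoc]; exact hs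
    · rw [he, hI]
      rw [hI] at hrs
      exact hrs.trans (dvd_of_eq (by ring))

/-- In a Noetherian normal domain, if `p` is the ideal of all `r` with `x ∣ r * y`, where
`x ∤ y`, then multiplication by the fraction `y / x` does not map `p` into itself. -/
lemma exists_mem_mul_eq_mul_notMem {R : Type*} [CommRing R] [IsDomain R] [IsNoetherianRing R]
    [IsIntegrallyClosed R] {x y : R} (hx : x ≠ 0) (hy : ¬ x ∣ y) {p : Ideal R}
    (hp : ∀ r, r ∈ p ↔ x ∣ r * y) : ∃ t ∈ p, ∃ u ∉ p, t * y = x * u := by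
  by_contra! hcon
  let K := FractionRing R
  have hxK : algebraMap R K x ≠ 0 := by simpa using hx
  have hxp : x ∈ p := (hp x).mpr (dvd_mul_right x y)
  have hint : IsIntegral R (algebraMap R K y / algebraMap R K x) := by
    refine isIntegral_of_smul_mem_submodule (M := K)
      (Submodule.map (Algebra.linearMap R K) p) ?_ ((IsNoetherian.noetherian p).map _) _ ?_
    · intro h0
      have : algebraMap R K x ∈ Submodule.map (Algebra.linearMap R K) p := ⟨x, hxp, rfl⟩
      rw [h0] at this
      exact hxK (by simpa using this)
    · rintro _ ⟨t, ht, rfl⟩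
      obtain ⟨u, hu⟩ := (hp t).mp ht
      refine ⟨u, by_contra fun hup ↦ hcon t ht u hup hu, ?_⟩
      have := congrArg (algebraMap R K) hu
      simp only [map_mul] at this
      simp only [Algebra.linearMap_apply, smul_eq_mul]
      rw [div_mul_eq_mul_div, eq_div_iff hxK]
      linear_combination -this
  obtain ⟨w, hw⟩ := IsIntegrallyClosed.isIntegral_iff.mp hint
  refine hy ⟨w, IsFractionRing.injective R K ?_⟩
  rw [map_mul, hw, mul_div_cancel₀ _ hxK]

/-- A prime of the form `{r | x ∣ r * y}` in a Noetherian domain has height at most one as soon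
as `y / x` maps one of its elements outside it. -/
lemma height_le_one_of_mul_eq_mul {R : Type*} [CommRing R] [IsDomain R] [IsNoetherianRing R]
    {x y t u : R} (hx : x ≠ 0) {p : Ideal R} (hpp : p.IsPrime)
    (hp : ∀ r ∈ p, x ∣ r * y) (ht : t ∈ p) (hu : u ∉ p) (htu : t * y = x * u) :
    p.height ≤ 1 := by
  refine Ideal.height_le_one_of_isPrincipal_of_mem_minimalPrimes (Ideal.span {t}) p
    ⟨⟨hpp, by simpa [Ideal.span_le] using ht⟩, fun p' ⟨hp', htp'⟩ hle r hr ↦ ?_⟩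
  obtain ⟨v, hv⟩ := hp r hr
  have key : r * u = t * v := mul_left_cancel₀ hx (by linear_combination t * hv - r * htu)
  have htmem : t ∈ p' := htp' (Ideal.mem_span_singleton_self t)
  have : r * u ∈ p' := key ▸ Ideal.mul_mem_right v p' htmem
  exact (hp'.mem_or_mem this).resolve_right fun h ↦ hu (hle h)

/-- Along an integral ring map, a prime has height at most that of its contraction. -/
lemma orderHeight_le_height_comap_of_isIntegral {R S : Type*} [CommRing R] [CommRing S]
    [Algebra R S] [Algebra.IsIntegral R S] (q : PrimeSpectrum S) :
    Order.height q ≤ (q.asIdeal.comap (algebraMap R S)).height := by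
  have hmono : StrictMono (PrimeSpectrum.comap (algebraMap R S)) := fun _ _ h ↦
    Ideal.IsIntegral.comap_lt_comap h
  exact (Order.height_le_height_apply_of_strictMono _ hmono q).trans_eq
    (PrimeSpectrum.height_eq_orderHeight _).symm

/-- Divisibility in an integral extension of a Noetherian normal domain, for elements of the
base, can be tested at height-one primes of the extension containing the divisor. -/
lemma dvd_of_forall_height_eq_one {R S : Type*} [CommRing R] [CommRing S] [IsDomain R]
    [IsDomain S] [IsNoetherianRing R] [IsIntegrallyClosed R] [Algebra R S]
    [Algebra.IsIntegral R S] (hinj : Function.Injective (algebraMap R S)) {x b : R} (hx : x ≠ 0)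
    (h : ∀ (q : Ideal S) (hq : q.IsPrime),
      Order.height (⟨q, hq⟩ : PrimeSpectrum S) = 1 → algebraMap R S x ∈ q →
      algebraMap S (Localization.AtPrime q) (algebraMap R S x) ∣
        algebraMap S (Localization.AtPrime q) (algebraMap R S b)) :
    x ∣ b := by
  by_contra hxb
  obtain ⟨p, c, hpp, hy, hp⟩ := exists_isPrime_mem_iff_dvd_mul hxb
  obtain ⟨t, ht, u, hu, htu⟩ := exists_mem_mul_eq_mul_notMem hx hy hp
  have hht := height_le_one_of_mul_eq_mul hx hpp (fun r ↦ (hp r).mp) ht hu htu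
  obtain ⟨q, hq, hqp⟩ := Ideal.exists_ideal_over_prime_of_isIntegral_of_isDomain (S := S) p
    (by rw [(RingHom.injective_iff_ker_eq_bot _).mp hinj]; exact bot_le)
  have hmem (r : R) : algebraMap R S r ∈ q ↔ r ∈ p := by rw [← hqp, Ideal.mem_comap]
  have hxq : algebraMap R S x ∈ q := (hmem x).mpr ((hp x).mpr (dvd_mul_right _ _))
  have hxS : algebraMap R S x ≠ 0 := by simpa using hinj.ne hx
  have hq1 : Order.height (⟨q, hq⟩ : PrimeSpectrum S) = 1 := by
    refine le_antisymm ((orderHeight_le_height_comap_of_isIntegral (R := R) _).trans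
      (by simpa [hqp] using hht)) ?_
    rw [Order.one_le_iff_pos]
    refine Order.height_pos_of_bot_lt (lt_of_le_of_ne bot_le fun h0 ↦ hxS ?_)
    have hbot : (⊥ : Ideal S) = q := congrArg PrimeSpectrum.asIdeal h0
    simpa [← hbot] using hxq
  obtain ⟨z, hz⟩ := h q hq hq1 hxq
  obtain ⟨⟨w, s⟩, hw⟩ := IsLocalization.surj q.primeCompl z
  have hsb : algebraMap R S b * s = algebraMap R S x * w := by
    apply IsLocalization.injective (Localization.AtPrime q) q.primeCompl_le_nonZeroDivisors
    simp only [map_mul]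
    rw [hz, ← hw]
    ring
  have hsu : s * algebraMap R S u = algebraMap R S t * algebraMap R S c * w := by
    apply mul_left_cancel₀ hxS
    have := congrArg (algebraMap R S) htu
    simp only [map_mul] at this
    linear_combination algebraMap R S t * algebraMap R S c * hsb - s * this
  have : s * algebraMap R S u ∈ q := by
    rw [hsu, mul_assoc]
    exact Ideal.mul_mem_right _ _ ((hmem t).mpr ht)
  exact (hq.mem_or_mem this).elim s.2 fun h' ↦ hu ((hmem u).mp h')


/-- Let `A → B` be an injective integral ring homomorphism of normal domains
with `A` Noetherian, and let `π` be a nonzero element of `A`. Assume that `B` is the union of a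
directed family of `A`-subalgebras, each of which is a Noetherian normal domain. Then for every
integer `n > 0` and every `b ∈ B`, if the image of `b` in `B_q` lies in `π^n·B_q` for every
height-one prime ideal `q` of `B` containing `π`, then `b ∈ π^n·B`; equivalently, the natural
map `B/π^nB → ∏_{q ∈ S_π(B)} B_q/π^nB_q` is injective. -/
theorem statement2 {A B : Type*} [CommRing A] [CommRing B] [IsDomain A] [IsDomain B]
    [IsIntegrallyClosed A] [IsIntegrallyClosed B] [IsNoetherianRing A]
    [Algebra A B] (hinj : Function.Injective (algebraMap A B))
    [Algebra.IsIntegral A B] {π : A} (hπ : π ≠ 0)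
    {ι : Type*} (F : ι → Subalgebra A B) (hdir : Directed (· ≤ ·) F)
    (hcover : ∀ b : B, ∃ i, b ∈ F i)
    (hnoeth : ∀ i, IsNoetherianRing (F i)) (hnorm : ∀ i, IsIntegrallyClosed (F i)) :
    ∀ n : ℕ, 0 < n → ∀ b : B,
      (∀ (q : Ideal B) (hq : q.IsPrime),
        Order.height (⟨q, hq⟩ : PrimeSpectrum B) = 1 → algebraMap A B π ∈ q →
        algebraMap B (Localization.AtPrime q) (algebraMap A B π) ^ n ∣
          algebraMap B (Localization.AtPrime q) b) →
      algebraMap A B π ^ n ∣ b := by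
  intro n hn b hb
  obtain ⟨i, hi⟩ := hcover b
  have := hnoeth i
  have := hnorm i
  have hF : Algebra.IsIntegral (F i) B := Algebra.IsIntegral.tower_top (R := A)
  have hπi : algebraMap A (F i) π ≠ 0 := fun h ↦ hπ <| hinj <| by
    simpa using congrArg (algebraMap (F i) B) h
  have hdvd : algebraMap A (F i) π ^ n ∣ (⟨b, hi⟩ : F i) := by
    refine dvd_of_forall_height_eq_one (S := B) Subtype.val_injective (pow_ne_zero n hπi)
      fun q hq hq1 hmem ↦ ?_
    have hmem' : algebraMap A B π ^ n ∈ q := by simpa using hmem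
    simpa using hb q hq hq1 (hq.mem_of_pow_mem n hmem')
  simpa using map_dvd (algebraMap (F i) B) hdvd
end

section
/- Let A be a commutative ring, π ∈ A, and f_• : M_• → N_• a morphism of chain complexes of A-modules (indexed by ℤ) such that the component f_n : M_n → N_n is a π-isomorphism for every n ∈ ℤ. Then for every n ∈ ℤ the induced map on homology H_n(M_•) → H_n(N_•) is a π²-isomorphism (in particular, f_• is a π²-quasi-isomorphism). -/
open CategoryTheory

universe u v w

namespace HomologicalComplex

variable {R : Type u} [Ring R] {ι : Type w} {c : ComplexShape ι}
  (K : HomologicalComplex (ModuleCat.{v} R) c)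

lemma moduleCat_homologyπ_surjective (i : ι) : Function.Surjective (K.homologyπ i) :=
  (ModuleCat.epi_iff_surjective _).1 inferInstance

lemma moduleCat_iCycles_injective (i : ι) : Function.Injective (K.iCycles i) :=
  (ModuleCat.mono_iff_injective _).1 inferInstance

lemma moduleCat_exists_iCycles_eq {i j : ι} (hj : c.next i = j) (x : K.X i)
    (hx : K.d i j x = 0) : ∃ z : K.cycles i, K.iCycles i z = x :=
  (ShortComplex.moduleCat_exact_iff _).1
    (ShortComplex.exact_of_f_is_kernel (.mk _ _ (K.iCycles_d i j)) (K.cyclesIsKernel i j hj)) x hx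

lemma moduleCat_homologyπ_eq_zero_iff {i j : ι} (hi : c.prev j = i) (z : K.cycles j) :
    K.homologyπ j z = 0 ↔ ∃ w : K.X i, K.d i j w = K.iCycles j z := by
  have key (w : K.X i) : K.iCycles j (K.toCycles i j w) = K.d i j w := by
    rw [← ConcreteCategory.comp_apply, K.toCycles_i]
  constructor
  · intro hz
    obtain ⟨w, rfl⟩ := (ShortComplex.moduleCat_exact_iff _).1
      (ShortComplex.exact_of_g_is_cokernel (.mk _ _ (K.toCycles_comp_homologyπ i j))
        (K.homologyIsCokernel i j hi)) z hz
    exact ⟨w, (key w).symm⟩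
  · rintro ⟨w, hw⟩
    obtain rfl : K.toCycles i j w = z := K.moduleCat_iCycles_injective j ((key w).trans hw)
    rw [← ConcreteCategory.comp_apply, K.toCycles_comp_homologyπ]
    rfl

end HomologicalComplex

/-- Let `A` be a commutative ring, `π ∈ A`, and `f : M → N` a morphism of chain
complexes of `A`-modules indexed by `ℤ` such that every component `f n : M n → N n` is a
`π`-isomorphism (kernel and cokernel annihilated by `π`). Then for every `n` the induced map on
homology `Hₙ(M) → Hₙ(N)` is a `π²`-isomorphism; in particular `f` is a `π²`-quasi-isomorphism. -/
theorem statement5 {A : Type} [CommRing A] (π : A)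
    {M N : ChainComplex (ModuleCat.{0} A) ℤ} (f : M ⟶ N)
    (hf : ∀ n : ℤ, (∀ x : M.X n, f.f n x = 0 → π • x = 0) ∧
      (∀ y : N.X n, ∃ x : M.X n, π • y = f.f n x)) :
    ∀ n : ℤ,
      (∀ x : M.homology n, HomologicalComplex.homologyMap f n x = 0 → (π ^ 2) • x = 0) ∧
      (∀ y : N.homology n, ∃ x : M.homology n,
        (π ^ 2) • y = HomologicalComplex.homologyMap f n x) := by
  intro n
  have hcomm (i j : ℤ) (x : M.X i) : f.f j (M.d i j x) = N.d i j (f.f i x) := by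
    rw [← ConcreteCategory.comp_apply, ← ConcreteCategory.comp_apply, f.comm]
  have hmap (z : M.cycles n) : HomologicalComplex.homologyMap f n (M.homologyπ n z) =
      N.homologyπ n (HomologicalComplex.cyclesMap f n z) := by
    rw [← ConcreteCategory.comp_apply, ← ConcreteCategory.comp_apply,
      HomologicalComplex.homologyπ_naturality]
  have hcyc (z : M.cycles n) : N.iCycles n (HomologicalComplex.cyclesMap f n z) =
      f.f n (M.iCycles n z) := by
    rw [← ConcreteCategory.comp_apply, ← ConcreteCategory.comp_apply,
      HomologicalComplex.cyclesMap_i]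
  constructor
  · intro x hx
    obtain ⟨z, rfl⟩ := M.moduleCat_homologyπ_surjective n x
    rw [hmap, N.moduleCat_homologyπ_eq_zero_iff rfl] at hx
    obtain ⟨y, hy⟩ := hx
    obtain ⟨w, hw⟩ := (hf _).2 y
    rw [← map_smul, M.moduleCat_homologyπ_eq_zero_iff rfl]
    refine ⟨π • w, ?_⟩
    have h := (hf n).1 (π • M.iCycles n z - M.d _ n w) (by
      rw [map_sub, map_smul, hcomm, ← hw, map_smul, hy, hcyc, sub_self])
    rw [smul_sub, sub_eq_zero] at h
    rw [map_smul, map_smul, pow_two, mul_smul, h]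
  · intro y
    obtain ⟨z, rfl⟩ := N.moduleCat_homologyπ_surjective n y
    obtain ⟨x, hx⟩ := (hf n).2 (N.iCycles n z)
    have hd : M.d n ((ComplexShape.down ℤ).next n) (π • x) = 0 := by
      rw [map_smul]
      refine (hf _).1 _ ?_
      rw [hcomm, ← hx, map_smul, ← ConcreteCategory.comp_apply, N.iCycles_d]
      exact smul_zero π
    obtain ⟨t, ht⟩ := M.moduleCat_exists_iCycles_eq rfl _ hd
    refine ⟨M.homologyπ n t, ?_⟩
    rw [hmap, ← map_smul]
    congr 1
    apply N.moduleCat_iCycles_injective n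
    rw [hcyc, ht, map_smul, map_smul, ← hx, pow_two, mul_smul]
end

section
/- Let A be a commutative ring, π ∈ A, F an additive A-linear endofunctor of the category of A-modules (so that F applied to π·g equals π·F(g) for any morphism g), and f : M → N a π-isomorphism of A-modules. Then F(f) : F(M) → F(N) is a π²-isomorphism. -/
open CategoryTheory

/-- A `π`-isomorphism of modules has an inverse up to `π ^ 2`. -/
theorem exists_comp_eq_sq_smul_id {A : Type*} [CommRing A] {M N : Type*}
    [AddCommGroup M] [Module A M] [AddCommGroup N] [Module A N] (π : A) (f : M →ₗ[A] N)
    (hker : ∀ x : M, f x = 0 → π • x = 0) (hcoker : ∀ y : N, ∃ x : M, π • y = f x) :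
    ∃ g : N →ₗ[A] M, g ∘ₗ f = π ^ 2 • LinearMap.id ∧ f ∘ₗ g = π ^ 2 • LinearMap.id := by
  have smul_eq {x x' : M} (h : f x = f x') : π • x = π • x' := by
    rw [← sub_eq_zero, ← smul_sub]
    exact hker _ (by rw [map_sub, h, sub_self])
  choose s hs using hcoker
  refine ⟨{ toFun := fun y => π • s y, map_add' := fun y z => ?_, map_smul' := fun a y => ?_ },
    ?_, ?_⟩
  · rw [← smul_add]
    exact smul_eq (by rw [map_add, ← hs, ← hs, ← hs, smul_add])
  · rw [RingHom.id_apply, smul_comm a π]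
    exact smul_eq (by rw [map_smul, ← hs, ← hs, smul_comm])
  · ext x
    have h : π • s (f x) = π • π • x := smul_eq (by rw [← hs, map_smul])
    simpa [pow_two, mul_smul] using h
  · ext y
    simp [pow_two, mul_smul, ← hs]

/-- Let `A` be a commutative ring, `π ∈ A`, `F` an additive `A`-linear
endofunctor of the category of `A`-modules (so `F (π • g) = π • F g` on morphisms), and
`f : M → N` a `π`-isomorphism of `A`-modules (kernel and cokernel annihilated by `π`).
Then `F f : F M → F N` is a `π²`-isomorphism. -/
theorem statement6 {A : Type} [CommRing A] (π : A)
    (F : ModuleCat.{0} A ⥤ ModuleCat.{0} A) [F.Additive] [F.Linear A]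
    {M N : ModuleCat.{0} A} (f : M ⟶ N)
    (hker : ∀ x : M, f x = 0 → π • x = 0)
    (hcoker : ∀ y : N, ∃ x : M, π • y = f x) :
    (∀ x : F.obj M, F.map f x = 0 → (π ^ 2) • x = 0) ∧
    (∀ y : F.obj N, ∃ x : F.obj M, (π ^ 2) • y = F.map f x) := by
  obtain ⟨g, hgf, hfg⟩ := exists_comp_eq_sq_smul_id π f.hom hker hcoker
  have hF₁ : F.map f ≫ F.map (ModuleCat.ofHom g) = π ^ 2 • 𝟙 (F.obj M) := by
    rw [← F.map_comp, ← F.map_id, ← F.map_smul]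
    exact congrArg F.map (ModuleCat.hom_ext hgf)
  have hF₂ : F.map (ModuleCat.ofHom g) ≫ F.map f = π ^ 2 • 𝟙 (F.obj N) := by
    rw [← F.map_comp, ← F.map_id, ← F.map_smul]
    exact congrArg F.map (ModuleCat.hom_ext hfg)
  refine ⟨fun x hx => ?_, fun y => ⟨F.map (ModuleCat.ofHom g) y, ?_⟩⟩
  · have h : F.map (ModuleCat.ofHom g) (F.map f x) = π ^ 2 • x := congrArg (fun k => k.hom x) hF₁
    rw [← h, hx, map_zero]
  · have h : F.map f (F.map (ModuleCat.ofHom g) y) = π ^ 2 • y := congrArg (fun k => k.hom y) hF₂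
    exact h.symm
end

section
/- Let A be a commutative ring, π ∈ A, and B → C a homomorphism of A-algebras which is a π-isomorphism (its kernel and cokernel are annihilated by π). Then the canonical base-change homomorphism C ⊗_B Ω¹_{B/A} → Ω¹_{C/A} of modules of Kähler differentials is a π^17-isomorphism. -/
open TensorProduct

namespace KaehlerDifferential

variable {A B C : Type*} [CommRing A] [CommRing B] [CommRing C]
  [Algebra A B] [Algebra A C] [Algebra B C] [IsScalarTower A B C]

/-- If elements of `B` with zero image in `C` are killed by `π`, then `π • (1 ⊗ db)` depends
only on the image of `b` in `C`. -/
theorem smul_one_tmul_D_eq {π : A} (hker : ∀ b : B, algebraMap B C b = 0 → π • b = 0)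
    {b b' : B} (h : algebraMap B C b = algebraMap B C b') :
    π • ((1 : C) ⊗ₜ[B] D A B b) = π • ((1 : C) ⊗ₜ[B] D A B b') := by
  have h0 : π • (b - b') = 0 := hker _ (by rw [map_sub, h, sub_self])
  rw [smul_sub, sub_eq_zero] at h0
  rw [← TensorProduct.tmul_smul, ← TensorProduct.tmul_smul, ← Derivation.map_smul,
    ← Derivation.map_smul, h0]

/-- For a `π`-isomorphism `B → C`, there is a derivation from `C` to `C ⊗[B] Ω[B⁄A]` sending `c`
to `π ^ 2 • (1 ⊗ db)` for any `b` lifting `π • c`. -/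
theorem exists_derivation_tensor (π : A)
    (hker : ∀ b : B, algebraMap B C b = 0 → π • b = 0)
    (hcoker : ∀ c : C, ∃ b : B, π • c = algebraMap B C b) :
    ∃ δ : Derivation A C (C ⊗[B] KaehlerDifferential A B), ∀ (c : C) (b : B),
      π • c = algebraMap B C b → δ c = π • π • ((1 : C) ⊗ₜ[B] D A B b) := by
  choose s hs using hcoker
  have hsmul (a : A) (b : B) : algebraMap B C (a • b) = a • algebraMap B C b :=
    map_smul (IsScalarTower.toAlgHom A B C) a b
  let δ : C →ₗ[A] C ⊗[B] KaehlerDifferential A B :=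
    { toFun c := π • π • ((1 : C) ⊗ₜ[B] D A B (s c))
      map_add' c c' := by
        rw [smul_one_tmul_D_eq hker (b := s (c + c')) (b' := s c + s c')
          (by rw [← hs, map_add, ← hs, ← hs, smul_add]), map_add, TensorProduct.tmul_add,
          smul_add, smul_add]
      map_smul' a c := by
        rw [smul_one_tmul_D_eq hker (b := s (a • c)) (b' := a • s c)
          (by rw [← hs, hsmul, ← hs, smul_comm]), Derivation.map_smul,
          TensorProduct.tmul_smul, RingHom.id_apply, smul_comm π a, smul_comm π a] }
  have hδ (c : C) : δ c = π • π • ((1 : C) ⊗ₜ[B] D A B (s c)) := rfl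
  refine ⟨Derivation.mk' δ fun c c' => ?_, fun c b hb => ?_⟩
  · have key : π • ((1 : C) ⊗ₜ[B] D A B (π • s (c * c'))) =
        π • ((1 : C) ⊗ₜ[B] D A B (s c * s c')) :=
      smul_one_tmul_D_eq hker (by
        rw [hsmul, ← hs, map_mul, ← hs, ← hs, smul_mul_smul_comm, smul_smul])
    have hb (e : C) (x : KaehlerDifferential A B) :
        (1 : C) ⊗ₜ[B] (s e • x) = π • e • ((1 : C) ⊗ₜ[B] x) := by
      rw [← TensorProduct.smul_tmul, ← algebraMap_smul C (s e) (1 : C), ← hs,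
        TensorProduct.smul_tmul', TensorProduct.smul_tmul', smul_assoc]
    rw [Derivation.map_smul, TensorProduct.tmul_smul, Derivation.leibniz,
      TensorProduct.tmul_add, hb, hb] at key
    rw [hδ, hδ, hδ, key, smul_add]
    simp only [smul_comm c, smul_comm c']
  · change δ c = _
    rw [hδ, smul_one_tmul_D_eq hker ((hs c).symm.trans hb)]

end KaehlerDifferential

/-- Let `A` be a commutative ring, `π ∈ A`, and `B → C` a homomorphism of
`A`-algebras which is a `π`-isomorphism (kernel and cokernel annihilated by `π`). Then the
canonical base-change homomorphism `C ⊗_B Ω¹_{B/A} → Ω¹_{C/A}` of modules of Kähler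
differentials is a `π^17`-isomorphism. -/
theorem statement7 {A B C : Type*} [CommRing A] [CommRing B] [CommRing C]
    [Algebra A B] [Algebra A C] [Algebra B C] [IsScalarTower A B C] (π : A)
    (hker : ∀ b : B, algebraMap B C b = 0 → π • b = 0)
    (hcoker : ∀ c : C, ∃ b : B, π • c = algebraMap B C b) :
    (∀ x : C ⊗[B] KaehlerDifferential A B,
      KaehlerDifferential.mapBaseChange A B C x = 0 → (algebraMap A C π) ^ 17 • x = 0) ∧
    (∀ y : KaehlerDifferential A C, ∃ x : C ⊗[B] KaehlerDifferential A B,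
      (algebraMap A C π) ^ 17 • y = KaehlerDifferential.mapBaseChange A B C x) := by
  constructor
  · obtain ⟨δ, hδ⟩ := KaehlerDifferential.exists_derivation_tensor π hker hcoker
    have hcomp (x : C ⊗[B] KaehlerDifferential A B) :
        δ.liftKaehlerDifferential (KaehlerDifferential.mapBaseChange A B C x) =
          (algebraMap A C π) ^ 3 • x := by
      induction x with
      | zero => simp
      | add x y hx hy => rw [map_add, map_add, hx, hy, smul_add]
      | tmul c w =>
        have hw : w ∈ Submodule.span B (Set.range (KaehlerDifferential.D A B)) := by
          rw [KaehlerDifferential.span_range_derivation]; trivial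
        induction hw using Submodule.span_induction generalizing c with
        | zero => simp
        | add x y _ _ hx hy =>
          rw [TensorProduct.tmul_add, map_add, map_add, hx, hy, smul_add]
        | smul b x _ hx => rw [← TensorProduct.smul_tmul]; exact hx _
        | mem x hx =>
          obtain ⟨b, rfl⟩ := hx
          rw [KaehlerDifferential.mapBaseChange_tmul, KaehlerDifferential.map_D, map_smul,
            Derivation.liftKaehlerDifferential_comp_D,
            hδ (algebraMap B C b) (π • b) (map_smul (IsScalarTower.toAlgHom A B C) π b).symm,
            Derivation.map_smul, TensorProduct.tmul_smul, ← map_pow, algebraMap_smul,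
            smul_comm c, smul_comm c, smul_comm c, TensorProduct.smul_tmul', smul_eq_mul, mul_one,
            smul_smul, smul_smul,
            pow_three']
    intro x hx
    have h3 := hcomp x
    rw [hx, map_zero] at h3
    rw [show 17 = 14 + 3 from rfl, pow_add, mul_smul, ← h3, smul_zero]
  · suffices h : ∀ y : KaehlerDifferential A C, algebraMap A C π • y ∈
        LinearMap.range (KaehlerDifferential.mapBaseChange A B C) by
      intro y
      obtain ⟨x, hx⟩ := h ((algebraMap A C π) ^ 16 • y)
      exact ⟨x, by rw [hx, smul_smul, ← pow_succ']⟩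
    intro y
    have hy : y ∈ Submodule.span C (Set.range (KaehlerDifferential.D A C)) := by
      rw [KaehlerDifferential.span_range_derivation]; trivial
    induction hy using Submodule.span_induction with
    | zero => simp
    | add x y _ _ hx hy => rw [smul_add]; exact add_mem hx hy
    | smul c x _ hx => rw [smul_comm]; exact Submodule.smul_mem _ c hx
    | mem x hx =>
      obtain ⟨c, rfl⟩ := hx
      obtain ⟨b, hb⟩ := hcoker c
      refine ⟨1 ⊗ₜ KaehlerDifferential.D A B b, ?_⟩
      rw [KaehlerDifferential.mapBaseChange_tmul, KaehlerDifferential.map_D, one_smul, ← hb,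
        Derivation.map_smul, algebraMap_smul]
end

section
/- Let A be a commutative ring, π ∈ A, let A' and B be two A-algebras, and set B' = A' ⊗_A B, viewed as an A'-algebra. If π annihilates both Ω¹_{B/A} and H¹Cotangent(A,B), then π² annihilates both Ω¹_{B'/A'} and H¹Cotangent(A',B'). -/
open TensorProduct

namespace Algebra
attribute [local instance] Algebra.TensorProduct.rightAlgebra

/-- An element of `A` annihilating `Ω[B⁄A]` annihilates the differentials of any base change. -/
theorem smul_kaehlerDifferential_baseChange_eq_zero {A A' B : Type*} [CommRing A]
    [CommRing A'] [CommRing B] [Algebra A A'] [Algebra A B] {π : A}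
    (h : ∀ x : KaehlerDifferential A B, algebraMap A B π • x = 0)
    (x : KaehlerDifferential A' (A' ⊗[A] B)) : algebraMap A (A' ⊗[A] B) π • x = 0 := by
  obtain ⟨y, rfl⟩ := (KaehlerDifferential.tensorKaehlerEquivBase A A' B (A' ⊗[A] B)).surjective x
  rw [IsScalarTower.algebraMap_apply A A' (A' ⊗[A] B), algebraMap_smul, ← map_smul]
  induction y with
  | zero => simp
  | add y z hy hz => rw [smul_add, map_add, hy, hz, add_zero]
  | tmul a y =>
    have := h y
    rw [algebraMap_smul] at this
    rw [algebraMap_smul, ← TensorProduct.tmul_smul, this]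
    simp

namespace Extension

variable {R S : Type*} [CommRing R] [CommRing S] [Algebra R S] (P : Extension R S)
variable (T : Type*) [CommRing T] [Algebra R T]

/-- The canonical map `T ⊗[R] P.Cotangent → P.baseChange.Cotangent`. -/
noncomputable def tensorToCotangent :
    T ⊗[R] P.Cotangent →ₗ[T] (P.baseChange (T := T)).Cotangent :=
  LinearMap.liftBaseChange T ((Cotangent.map (P.toBaseChange T)).restrictScalars R)

@[simp]
lemma tensorToCotangent_tmul (t : T) (x : P.Cotangent) :
    P.tensorToCotangent T (t ⊗ₜ x) = t • Cotangent.map (P.toBaseChange T) x := rfl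

lemma tensorToCotangent_surjective : Function.Surjective (P.tensorToCotangent T) := by
  intro x
  obtain ⟨⟨x, hx⟩, rfl⟩ := Cotangent.mk_surjective x
  obtain ⟨y, rfl⟩ := P.ker.map_includeRight_eq.le ((P.ker_baseChange T).le hx)
  induction y with
  | zero => exact ⟨0, by simp only [map_zero]; exact (map_zero _).symm⟩
  | add x y hx' hy' =>
    obtain ⟨a, ha⟩ := hx' ((P.ker_baseChange T).ge (P.ker.map_includeRight_eq.ge ⟨x, rfl⟩))
    obtain ⟨b, hb⟩ := hy' ((P.ker_baseChange T).ge (P.ker.map_includeRight_eq.ge ⟨y, rfl⟩))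
    exact ⟨a + b, by simp only [map_add, ha, hb]; rfl⟩
  | tmul t x =>
    use t ⊗ₜ Cotangent.mk x
    obtain ⟨x, hx'⟩ := x
    change x ∈ P.ker at hx'
    have : P.tensorToCotangent T (t ⊗ₜ Cotangent.mk ⟨x, hx'⟩) =
      t • Cotangent.mk ⟨(P.toBaseChange T).toAlgHom x, _⟩ :=
        (P.tensorToCotangent_tmul T _ _).trans (congrArg _ (Cotangent.map_mk _ _))
    refine this.trans ?_
    rw [← algebraMap_smul (P.baseChange (T := T)).Ring t, ← map_smul]
    refine congrArg _ (Subtype.ext ?_)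
    change (t ⊗ₜ[R] (1 : P.Ring)) * ((1 : T) ⊗ₜ[R] x) = t ⊗ₜ[R] x
    simp

lemma cotangentComplex_tensorToCotangent (z) :
    (P.baseChange (T := T)).cotangentComplex (P.tensorToCotangent T z) =
      P.tensorCotangentSpace T ((P.cotangentComplex.restrictScalars R).lTensor T z) := by
  induction z with
  | zero => simp
  | add x y hx hy => simp [hx, hy]
  | tmul t x =>
    simp [CotangentSpace.map_cotangentComplex]

/-- If `π` annihilates `Ω[S⁄R]` and the cotangent space is projective, multiplication by `π` on
the cotangent space factors through the cotangent complex. -/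
lemma exists_cotangentComplex_comp_eq_smul (π : S) [Module.Projective S P.CotangentSpace]
    (h : ∀ x : KaehlerDifferential R S, π • x = 0) :
    ∃ s : P.CotangentSpace →ₗ[S] P.Cotangent, P.cotangentComplex ∘ₗ s = π • LinearMap.id := by
  have hr : ∀ x, π • x ∈ P.cotangentComplex.range := fun x ↦
    (P.exact_cotangentComplex_toKaehler _).mp (by rw [map_smul, h])
  obtain ⟨s, hs⟩ := Module.projective_lifting_property P.cotangentComplex.rangeRestrict
    ((π • LinearMap.id : P.CotangentSpace →ₗ[S] _).codRestrict _ hr)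
    P.cotangentComplex.surjective_rangeRestrict
  refine ⟨s, LinearMap.ext fun x ↦ ?_⟩
  exact congr_arg Subtype.val (LinearMap.congr_fun hs x)

/-- If moreover `π` annihilates the first homology, multiplication by `π ^ 2` on the cotangent
module factors through the cotangent complex. -/
lemma exists_comp_cotangentComplex_eq_sq_smul (π : S) [Module.Projective S P.CotangentSpace]
    (h : ∀ x : KaehlerDifferential R S, π • x = 0) (h' : ∀ x : P.H1Cotangent, π • x = 0) :
    ∃ s : P.CotangentSpace →ₗ[S] P.Cotangent, s ∘ₗ P.cotangentComplex = π ^ 2 • LinearMap.id := by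
  obtain ⟨s, hs⟩ := P.exists_cotangentComplex_comp_eq_smul π h
  refine ⟨π • s, LinearMap.ext fun x ↦ ?_⟩
  have hx : s (P.cotangentComplex x) - π • x ∈ LinearMap.ker P.cotangentComplex := by
    have := LinearMap.congr_fun hs (P.cotangentComplex x)
    simp only [LinearMap.comp_apply] at this
    simp [this]
  have := congr_arg Subtype.val (h' ⟨_, hx⟩)
  have h2 : π • (s (P.cotangentComplex x) - π • x) = 0 := this
  rw [smul_sub, sub_eq_zero, smul_smul] at h2
  simpa [sq] using h2

/-- If the cotangent space is projective and `π` annihilates both `Ω[S⁄R]` and the first homology,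
then `π ^ 2` annihilates the first homology of any base change. -/
lemma sq_smul_h1Cotangent_baseChange_eq_zero {π : R} [Module.Projective S P.CotangentSpace]
    (h : ∀ x : KaehlerDifferential R S, algebraMap R S π • x = 0)
    (h' : ∀ x : P.H1Cotangent, algebraMap R S π • x = 0)
    (x : (P.baseChange (T := T)).H1Cotangent) :
    algebraMap R (T ⊗[R] S) π ^ 2 • x = 0 := by
  obtain ⟨s, hs⟩ := P.exists_comp_cotangentComplex_eq_sq_smul _ h h'
  obtain ⟨z, hz⟩ := P.tensorToCotangent_surjective T x.1
  have hx : (P.baseChange (T := T)).cotangentComplex x.1 = 0 := x.2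
  rw [← hz, cotangentComplex_tensorToCotangent, LinearEquiv.map_eq_zero_iff] at hx
  have hs' : s.restrictScalars R ∘ₗ P.cotangentComplex.restrictScalars R =
      π ^ 2 • LinearMap.id := by
    ext1 y
    have := LinearMap.congr_fun hs y
    rw [← map_pow] at this
    exact this.trans (algebraMap_smul S (π ^ 2) y)
  have h0 : π ^ 2 • z = 0 := by
    have := congr_arg ((s.restrictScalars R).lTensor T) hx
    rw [← LinearMap.comp_apply, ← LinearMap.lTensor_comp, hs'] at this
    simpa using this
  apply h1Cotangentι_injective
  have h3 : (algebraMap R T π) ^ 2 • z = 0 := by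
    rw [← map_pow, algebraMap_smul, h0]
  rw [map_smul, map_zero, IsScalarTower.algebraMap_apply R T (T ⊗[R] S), ← map_pow, algebraMap_smul]
  change _ • x.1 = 0
  rw [← hz, ← map_smul, h3, map_zero]

end Extension

end Algebra

/-- Let `A` be a commutative ring, `π ∈ A`, let `A'` and `B` be two
`A`-algebras, and set `B' = A' ⊗_A B`. If `π` annihilates both `Ω¹_{B/A}` and
`H¹Cotangent(A,B)` (i.e. `τ≤1 L_{B/A}` is `π`-exact), then `π²` annihilates both
`Ω¹_{B'/A'}` and `H¹Cotangent(A',B')` (i.e. `τ≤1 L_{B'/A'}` is `π²`-exact). -/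
theorem statement8 {A A' B : Type*} [CommRing A] [CommRing A'] [CommRing B]
    [Algebra A A'] [Algebra A B] (π : A)
    (h1 : ∀ x : KaehlerDifferential A B, algebraMap A B π • x = 0)
    (h2 : ∀ x : Algebra.H1Cotangent A B, algebraMap A B π • x = 0) :
    (∀ x : KaehlerDifferential A' (A' ⊗[A] B),
      (algebraMap A (A' ⊗[A] B) π) ^ 2 • x = 0) ∧
    (∀ x : Algebra.H1Cotangent A' (A' ⊗[A] B),
      (algebraMap A (A' ⊗[A] B) π) ^ 2 • x = 0) := by
  refine ⟨fun x ↦ ?_, fun x ↦ ?_⟩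
  · rw [sq, mul_smul, Algebra.smul_kaehlerDifferential_baseChange_eq_zero h1]
  · let e := (Algebra.Extension.H1Cotangent.equiv
      ((Algebra.Generators.self A B).baseChangeFromBaseChange A')
      ((Algebra.Generators.self A B).baseChangeToBaseChange A')) ≪≫ₗ
      ((Algebra.Generators.self A B).baseChange (T := A')).equivH1Cotangent
    obtain ⟨y, rfl⟩ := e.surjective x
    rw [← map_smul, Algebra.Extension.sq_smul_h1Cotangent_baseChange_eq_zero _ _ h1 h2, map_zero]
end

section
/- Let A be a commutative ring, π ∈ A, B an A-algebra and C a B-algebra (so C is an A-algebra via the composite, with compatible scalar actions). If π annihilates Ω¹_{C/B} and H¹Cotangent(B,C), and π annihilates Ω¹_{B/A} and H¹Cotangent(A,B), then π³ annihilates both Ω¹_{C/A} and H¹Cotangent(A,C). -/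
open KaehlerDifferential TensorProduct

namespace LinearMap

/-- If `p` annihilates both the kernel and the cokernel of a linear map `d : M → N` with `N`
projective, then, up to a factor `p`, multiplication by `p` on `M` factors through `d`. -/
lemma exists_smul_comp_eq_sq_smul {S M N K : Type*} [CommRing S] [AddCommGroup M] [Module S M]
    [AddCommGroup N] [Module S N] [AddCommGroup K] [Module S K] [Module.Projective S N]
    {d : M →ₗ[S] N} {q : N →ₗ[S] K} (hdq : Function.Exact d q) {p : S}
    (hker : ∀ x, d x = 0 → p • x = 0) (hcoker : ∀ x : K, p • x = 0) :
    ∃ s : N →ₗ[S] M, p • (s ∘ₗ d) = p ^ 2 • LinearMap.id := by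
  have hr (x : N) : p • x ∈ LinearMap.range d := (hdq _).1 (by rw [map_smul, hcoker])
  obtain ⟨s, hs⟩ := Module.projective_lifting_property d.rangeRestrict
    ((p • LinearMap.id : N →ₗ[S] N).codRestrict (LinearMap.range d) hr) d.surjective_rangeRestrict
  have hs' (x : N) : d (s x) = p • x := congr_arg Subtype.val (LinearMap.congr_fun hs x)
  refine ⟨s, LinearMap.ext fun x ↦ ?_⟩
  have := hker (s (d x) - p • x) (by rw [map_sub, hs', map_smul, sub_self])
  rw [smul_sub, sub_eq_zero, smul_smul, ← pow_two] at this
  exact this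

/-- If `p` annihilates both the kernel and the cokernel of a linear map with projective target,
then `p ^ 2` annihilates the kernel of every base change of it. -/
lemma sq_smul_eq_zero_of_baseChange_eq_zero {S M N K : Type*} (T : Type*) [CommRing S]
    [CommRing T] [Algebra S T] [AddCommGroup M] [Module S M] [AddCommGroup N] [Module S N]
    [AddCommGroup K] [Module S K] [Module.Projective S N]
    {d : M →ₗ[S] N} {q : N →ₗ[S] K} (hdq : Function.Exact d q) {p : S}
    (hker : ∀ x, d x = 0 → p • x = 0) (hcoker : ∀ x : K, p • x = 0)
    {y : T ⊗[S] M} (hy : d.baseChange T y = 0) : algebraMap S T p ^ 2 • y = 0 := by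
  obtain ⟨s, hs⟩ := exists_smul_comp_eq_sq_smul hdq hker hcoker
  have h := LinearMap.congr_fun (congr_arg (LinearMap.baseChange T) hs) y
  rw [baseChange_smul, baseChange_smul, baseChange_comp, baseChange_id] at h
  rw [← map_pow, algebraMap_smul]
  simpa [hy] using h.symm

end LinearMap

namespace Algebra

variable {R S T : Type*} [CommRing R] [CommRing S] [CommRing T] [Algebra R S] [Algebra S T]
  [Algebra R T] [IsScalarTower R S T]

/-- If `p` annihilates `Ω[S⁄R]` and `H¹(L_{S/R})`, then `p ^ 2` annihilates the kernel of
`H¹(L_{T/R}) → H¹(L_{T/S})`, computed on a composition of generators. -/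
lemma Generators.sq_smul_eq_zero_of_map_ofComp_eq_zero {ι σ : Type*} (Q : Generators S T ι)
    (P : Generators R S σ) {p : S} (hΩ : ∀ x : Ω[S⁄R], p • x = 0)
    (hH : ∀ x : P.toExtension.H1Cotangent, p • x = 0)
    {x : (Q.comp P).toExtension.H1Cotangent}
    (hx : Extension.H1Cotangent.map (Q.ofComp P).toExtensionHom x = 0) :
    algebraMap S T p ^ 2 • x = 0 := by
  have hx' : Extension.Cotangent.map (Q.ofComp P).toExtensionHom x.1 = 0 :=
    congr_arg Subtype.val hx
  obtain ⟨y, hy⟩ := (Cotangent.exact Q P _).1 hx'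
  have hd : P.toExtension.cotangentComplex.baseChange T y = 0 := by
    apply CotangentSpace.map_toComp_injective Q P
    rw [map_zero]
    refine (LinearMap.congr_fun (H1Cotangent.map_comp_cotangentComplex_baseChange Q P) y).trans ?_
    rw [LinearMap.comp_apply, hy]
    exact x.2
  have h0 := LinearMap.sq_smul_eq_zero_of_baseChange_eq_zero T
    P.toExtension.exact_cotangentComplex_toKaehler
    (fun z hz ↦ congr_arg Subtype.val (hH ⟨z, hz⟩)) hΩ hd
  apply Extension.h1Cotangentι_injective
  rw [map_smul, map_zero]
  change _ • x.1 = 0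
  rw [← hy, ← map_smul, h0, map_zero]

/-- If `p` annihilates `Ω[S⁄R]` and `H¹(L_{S/R})`, then `p ^ 2` annihilates the kernel of
`H¹(L_{T/R}) → H¹(L_{T/S})`. -/
lemma H1Cotangent.sq_smul_eq_zero_of_map_eq_zero {p : S} (hΩ : ∀ x : Ω[S⁄R], p • x = 0)
    (hH : ∀ x : H1Cotangent R S, p • x = 0) {x : H1Cotangent R T}
    (hx : H1Cotangent.map R S T T x = 0) : algebraMap S T p ^ 2 • x = 0 := by
  let Q := Generators.self S T
  let P := Generators.self R S
  let e := Generators.H1Cotangent.equiv (Generators.self R T) (Q.comp P)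
  apply e.injective
  rw [map_smul, map_zero]
  apply Generators.sq_smul_eq_zero_of_map_ofComp_eq_zero Q P hΩ hH
  refine Eq.trans ?_ hx
  change Extension.H1Cotangent.map (Q.ofComp P).toExtensionHom
    (Extension.H1Cotangent.map _ x) = Extension.H1Cotangent.map _ x
  rw [← Extension.H1Cotangent.map_comp_apply, Extension.H1Cotangent.map_eq]

end Algebra

namespace KaehlerDifferential

/-- If `p` annihilates `Ω[S⁄R]`, then its image in `T` annihilates the kernel of
`Ω[T⁄R] → Ω[T⁄S]`. -/
lemma smul_eq_zero_of_map_eq_zero {R S T : Type*} [CommRing R] [CommRing S] [CommRing T]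
    [Algebra R S] [Algebra S T] [Algebra R T] [IsScalarTower R S T] {p : S}
    (hΩ : ∀ x : Ω[S⁄R], p • x = 0) {x : Ω[T⁄R]} (hx : map R S T T x = 0) :
    algebraMap S T p • x = 0 := by
  obtain ⟨y, rfl⟩ := (exact_mapBaseChange_map R S T x).1 hx
  rw [← map_smul, algebraMap_smul]
  suffices p • y = 0 by rw [this, map_zero]
  clear hx
  induction y with
  | zero => exact smul_zero p
  | tmul t z => rw [← TensorProduct.tmul_smul, hΩ, TensorProduct.tmul_zero]
  | add y z hy hz => rw [smul_add, hy, hz, add_zero]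

end KaehlerDifferential


/-- Let `A` be a commutative ring, `π ∈ A`, `B` an `A`-algebra and `C` a
`B`-algebra (with compatible `A`-algebra structure). If `π` annihilates `Ω¹_{C/B}` and
`H¹Cotangent(B,C)`, and `π` annihilates `Ω¹_{B/A}` and `H¹Cotangent(A,B)`, then `π³`
annihilates both `Ω¹_{C/A}` and `H¹Cotangent(A,C)`. -/
theorem statement9 {A B C : Type*} [CommRing A] [CommRing B] [CommRing C]
    [Algebra A B] [Algebra B C] [Algebra A C] [IsScalarTower A B C] (π : A)
    (h1 : ∀ x : KaehlerDifferential B C, algebraMap A C π • x = 0)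
    (h2 : ∀ x : Algebra.H1Cotangent B C, algebraMap A C π • x = 0)
    (h3 : ∀ x : KaehlerDifferential A B, algebraMap A B π • x = 0)
    (h4 : ∀ x : Algebra.H1Cotangent A B, algebraMap A B π • x = 0) :
    (∀ x : KaehlerDifferential A C, (algebraMap A C π) ^ 3 • x = 0) ∧
    (∀ x : Algebra.H1Cotangent A C, (algebraMap A C π) ^ 3 • x = 0) := by
  have hπ : algebraMap A C π = algebraMap B C (algebraMap A B π) :=
    IsScalarTower.algebraMap_apply A B C π
  constructor
  · intro x
    have h := KaehlerDifferential.smul_eq_zero_of_map_eq_zero h3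
      (x := algebraMap A C π • x) (by rw [map_smul]; exact h1 _)
    rw [← hπ, smul_smul, ← pow_two] at h
    rw [pow_succ', mul_smul, h, smul_zero]
  · intro x
    have h := Algebra.H1Cotangent.sq_smul_eq_zero_of_map_eq_zero h3 h4
      (x := algebraMap A C π • x) (by rw [map_smul]; exact h2 _)
    rwa [← hπ, smul_smul, ← pow_succ] at h
end

section
/- Let A be a commutative ring, π ∈ A, and B an A-algebra such that the structure homomorphism A → B is a π-isomorphism of A-modules (its kernel and cokernel are annihilated by π). Then π^102 annihilates both Ω¹_{B/A} and H¹Cotangent(A,B); that is, τ≤1 L_{B/A} is π^102-exact. -/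
namespace Algebra.Extension

variable {A B : Type*} [CommRing A] [CommRing B] [Algebra A B] (P : Extension A B) {π : A}

theorem smul_sub_algebraMap_mem_ker {s : B → A}
    (hs : ∀ b : B, π • b = algebraMap A B (s b)) (p : P.Ring) :
    algebraMap A P.Ring π * p - algebraMap A P.Ring (s (algebraMap P.Ring B p)) ∈ P.ker := by
  change algebraMap P.Ring B _ = 0
  rw [map_sub, map_mul, ← IsScalarTower.algebraMap_apply, ← IsScalarTower.algebraMap_apply, ← hs,
    Algebra.smul_def, sub_self]

theorem algebraMap_mul_eq_of_algebraMap_eq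
    (hker : ∀ a : A, algebraMap A B a = 0 → π * a = 0) {a a' : A}
    (h : algebraMap A B a = algebraMap A B a') :
    algebraMap A P.Ring π * algebraMap A P.Ring a =
      algebraMap A P.Ring π * algebraMap A P.Ring a' := by
  rw [← map_mul, ← map_mul]
  congr 1
  have := hker (a - a') (by rw [map_sub, h, sub_self])
  linear_combination this

/-- If `A → B` is a `π`-isomorphism, with `s b` a preimage of `π • b`, then
`p ↦ π ^ 2 * (π * p - s p)` defines an `A`-derivation from `P` to `I / I ^ 2`, where `I` is the
kernel of `P → B`. -/
noncomputable def derivationOfPiIso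
    (hker : ∀ a : A, algebraMap A B a = 0 → π * a = 0) {s : B → A}
    (hs : ∀ b : B, π • b = algebraMap A B (s b)) :
    Derivation A P.Ring P.Cotangent :=
  Derivation.mk'
    { toFun := fun p ↦ algebraMap A P.Ring π ^ 2 •
        Cotangent.mk ⟨_, P.smul_sub_algebraMap_mem_ker hs p⟩
      map_add' := fun p q ↦ by
        simp only [← map_smul, ← map_add]
        congr 1
        ext
        simp only [Submodule.coe_smul, Submodule.coe_add, smul_eq_mul]
        have h := P.algebraMap_mul_eq_of_algebraMap_eq hker
          (a := s (algebraMap P.Ring B (p + q)))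
          (a' := s (algebraMap P.Ring B p) + s (algebraMap P.Ring B q))
          (by simp only [map_add, ← hs, smul_add])
        rw [map_add (algebraMap A P.Ring)] at h
        linear_combination -algebraMap A P.Ring π * h
      map_smul' := fun a p ↦ by
        rw [RingHom.id_apply, ← algebraMap_smul P.Ring a (_ : P.Cotangent)]
        simp only [← map_smul]
        congr 1
        ext
        simp only [Submodule.coe_smul, smul_eq_mul]
        have h := P.algebraMap_mul_eq_of_algebraMap_eq hker
          (a := s (algebraMap P.Ring B (a • p))) (a' := a * s (algebraMap P.Ring B p))
          (by rw [map_mul, ← hs, ← hs, Algebra.smul_def a p, map_mul,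
                ← IsScalarTower.algebraMap_apply, mul_smul_comm])
        rw [map_mul (algebraMap A P.Ring)] at h
        rw [Algebra.smul_def a p] at h ⊢
        linear_combination -algebraMap A P.Ring π * h }
    fun p q ↦ by
      simp only [LinearMap.coe_mk, AddHom.coe_mk, ← map_smul, ← map_add]
      rw [Cotangent.mk_eq_mk_iff_sub_mem]
      simp only [Submodule.coe_smul, Submodule.coe_add, smul_eq_mul]
      have h := P.algebraMap_mul_eq_of_algebraMap_eq hker
        (a := π * s (algebraMap P.Ring B (p * q)))
        (a' := s (algebraMap P.Ring B p) * s (algebraMap P.Ring B q))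
        (by simp only [map_mul, ← hs, Algebra.smul_def]; ring)
      rw [map_mul (algebraMap A P.Ring), map_mul (algebraMap A P.Ring)] at h
      have hmem := Ideal.mul_mem_left (P.ker ^ 2) (-algebraMap A P.Ring π) (pow_two P.ker ▸
        Ideal.mul_mem_mul (P.smul_sub_algebraMap_mem_ker hs p)
          (P.smul_sub_algebraMap_mem_ker hs q))
      convert hmem using 1
      linear_combination -h

theorem derivationOfPiIso_apply_ker
    (hker : ∀ a : A, algebraMap A B a = 0 → π * a = 0) {s : B → A}
    (hs : ∀ b : B, π • b = algebraMap A B (s b)) (x : P.ker) :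
    P.derivationOfPiIso hker hs x = algebraMap A P.Ring π ^ 3 • Cotangent.mk x := by
  change algebraMap A P.Ring π ^ 2 • Cotangent.mk ⟨_, P.smul_sub_algebraMap_mem_ker hs x⟩ = _
  simp only [← map_smul]
  congr 1
  ext
  simp only [Submodule.coe_smul, smul_eq_mul]
  have hx : algebraMap P.Ring B x = 0 := x.2
  have h := P.algebraMap_mul_eq_of_algebraMap_eq hker
    (a := s (algebraMap P.Ring B x)) (a' := 0) (by rw [← hs, hx, smul_zero, map_zero])
  rw [map_zero, mul_zero] at h
  linear_combination -algebraMap A P.Ring π * h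

theorem algebraMap_pow_three_smul_h1Cotangent
    (hker : ∀ a : A, algebraMap A B a = 0 → π * a = 0) {s : B → A}
    (hs : ∀ b : B, π • b = algebraMap A B (s b)) (x : P.H1Cotangent) :
    algebraMap A B π ^ 3 • x = 0 := by
  obtain ⟨x, hx⟩ := x
  apply Subtype.ext
  change algebraMap A B π ^ 3 • x = 0
  obtain ⟨y, rfl⟩ := Cotangent.mk_surjective x
  have h : (P.derivationOfPiIso hker hs).liftKaehlerDifferential.liftBaseChange B
      (P.cotangentComplex (Cotangent.mk y)) = 0 := by
    rw [LinearMap.mem_ker.mp hx, map_zero]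
  rw [cotangentComplex_mk, LinearMap.liftBaseChange_tmul, one_smul,
    Derivation.liftKaehlerDifferential_comp_D, derivationOfPiIso_apply_ker,
    ← algebraMap_smul B, map_pow, ← IsScalarTower.algebraMap_apply] at h
  exact h

end Algebra.Extension

theorem KaehlerDifferential.algebraMap_smul_eq_zero {A B : Type*} [CommRing A] [CommRing B]
    [Algebra A B] {π : A} (hcoker : ∀ b : B, ∃ a : A, π • b = algebraMap A B a)
    (x : KaehlerDifferential A B) : algebraMap A B π • x = 0 := by
  have hx : x ∈ Submodule.span B (Set.range (KaehlerDifferential.D A B)) := by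
    rw [KaehlerDifferential.span_range_derivation]
    trivial
  induction hx using Submodule.span_induction with
  | mem x hx =>
    obtain ⟨b, rfl⟩ := hx
    obtain ⟨a, ha⟩ := hcoker b
    rw [algebraMap_smul, ← Derivation.map_smul, ha, Derivation.map_algebraMap]
  | zero => exact smul_zero _
  | add x y _ _ hx hy => rw [smul_add, hx, hy, add_zero]
  | smul b x _ hx => rw [smul_comm, hx, smul_zero]

/-- Let `A` be a commutative ring, `π ∈ A`, and `B` an `A`-algebra such that
the structure homomorphism `A → B` is a `π`-isomorphism of `A`-modules (kernel and cokernel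
annihilated by `π`). Then `π^102` annihilates both `Ω¹_{B/A}` and `H¹Cotangent(A,B)`, i.e.
`τ≤1 L_{B/A}` is `π^102`-exact. -/
theorem statement10 {A B : Type*} [CommRing A] [CommRing B] [Algebra A B] (π : A)
    (hker : ∀ a : A, algebraMap A B a = 0 → π * a = 0)
    (hcoker : ∀ b : B, ∃ a : A, π • b = algebraMap A B a) :
    (∀ x : KaehlerDifferential A B, algebraMap A B π ^ 102 • x = 0) ∧
    (∀ x : Algebra.H1Cotangent A B, algebraMap A B π ^ 102 • x = 0) := by
  choose s hs using hcoker
  refine ⟨fun x ↦ ?_, fun x ↦ ?_⟩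
  · rw [pow_succ, mul_smul, KaehlerDifferential.algebraMap_smul_eq_zero fun b ↦ ⟨s b, hs b⟩,
      smul_zero]
  · rw [show 102 = 99 + 3 from rfl, pow_add, mul_smul,
      Algebra.Extension.algebraMap_pow_three_smul_h1Cotangent _ hker hs, smul_zero]
end

section
/- Let A be a Noetherian commutative ring, B an A-algebra of finite type, and π ∈ A. Assume that after inverting π the induced homomorphism A[1/π] → B[1/π] of localizations is étale. Then there exists k ∈ ℕ such that π^k annihilates both Ω¹_{B/A} and H¹Cotangent(A,B); that is, τ≤1 L_{B/A} is π^k-exact. -/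
namespace IsLocalizedModule.Away

variable {R M M' : Type*} [CommRing R] [AddCommGroup M] [Module R M] [AddCommGroup M'] [Module R M']

theorem exists_pow_smul_eq_zero [Module.Finite R M] [Subsingleton M'] (r : R) (f : M →ₗ[R] M')
    [IsLocalizedModule.Away r f] : ∃ k : ℕ, ∀ x : M, r ^ k • x = 0 := by
  obtain ⟨s, hs⟩ := Module.Finite.fg_top (R := R) (M := M)
  have H := (IsLocalizedModule.subsingleton_iff (.powers r) f).mp ‹_›
  simp only [Submonoid.mem_powers_iff, exists_exists_eq_and] at H
  choose n hn using H
  refine ⟨s.sup n, fun x ↦ ?_⟩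
  have hx : x ∈ Submodule.span R (s : Set M) := hs ▸ Submodule.mem_top
  induction hx using Submodule.span_induction with
  | mem x hx =>
    rw [← Nat.sub_add_cancel (Finset.le_sup (f := n) hx), pow_add, mul_smul, hn, smul_zero]
  | zero => exact smul_zero _
  | add x y _ _ hx hy => rw [smul_add, hx, hy, add_zero]
  | smul a x _ hx => rw [smul_comm, hx, smul_zero]

end IsLocalizedModule.Away

namespace Algebra

theorem H1Cotangent.finite_of_isNoetherianRing (R S : Type*) [CommRing R] [CommRing S]
    [Algebra R S] [IsNoetherianRing R] [Algebra.FiniteType R S] :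
    Module.Finite S (Algebra.H1Cotangent R S) := by
  have : FinitePresentation R S := FinitePresentation.of_finiteType.mp ‹_›
  have : IsNoetherianRing S := FiniteType.isNoetherianRing R S
  let P := Presentation.ofFinitePresentation R S
  have : Module.Finite S P.toExtension.Cotangent := Extension.Cotangent.finite P.fg_ker
  have : Module.Finite S P.toExtension.H1Cotangent :=
    .of_injective P.toExtension.h1Cotangentι P.toExtension.h1Cotangentι_injective
  exact .equiv P.equivH1Cotangent

end Algebra

/-- Let `A` be a Noetherian commutative ring, `B` an `A`-algebra of finite
type, and `π ∈ A`. Assume that after inverting `π` the induced homomorphism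
`A[1/π] → B[1/π]` is étale (here `Aπ` and `Bπ` are models of these localizations, compatibly).
Then there exists `k ∈ ℕ` such that `π^k` annihilates both `Ω¹_{B/A}` and `H¹Cotangent(A,B)`,
i.e. `τ≤1 L_{B/A}` is `π^k`-exact. -/
theorem statement11 {A B : Type u} [CommRing A] [IsNoetherianRing A] [CommRing B] [Algebra A B]
    [Algebra.FiniteType A B] (π : A)
    (Aπ Bπ : Type u) [CommRing Aπ] [CommRing Bπ]
    [Algebra A Aπ] [IsLocalization.Away π Aπ]
    [Algebra B Bπ] [IsLocalization.Away (algebraMap A B π) Bπ]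
    [Algebra Aπ Bπ] [Algebra A Bπ] [IsScalarTower A Aπ Bπ] [IsScalarTower A B Bπ]
    (hetale : Algebra.Etale Aπ Bπ) :
    ∃ k : ℕ, (∀ x : KaehlerDifferential A B, algebraMap A B π ^ k • x = 0) ∧
      (∀ x : Algebra.H1Cotangent A B, algebraMap A B π ^ k • x = 0) := by
  have : Algebra.Etale A Aπ := .of_isLocalizationAway π
  have : Algebra.Etale A Bπ := .comp A Aπ Bπ
  have := Algebra.H1Cotangent.finite_of_isNoetherianRing A B
  obtain ⟨m, hm⟩ := IsLocalizedModule.Away.exists_pow_smul_eq_zero (algebraMap A B π)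
    (KaehlerDifferential.map A A B Bπ)
  obtain ⟨n, hn⟩ := IsLocalizedModule.Away.exists_pow_smul_eq_zero (algebraMap A B π)
    (Algebra.H1Cotangent.map A A B Bπ)
  refine ⟨m + n, fun x ↦ ?_, fun x ↦ ?_⟩
  · rw [pow_add, mul_comm, mul_smul, hm, smul_zero]
  · rw [pow_add, mul_smul, hn, smul_zero]
end

section
/- Let A be a commutative ring, π ∈ A, I an ideal of A containing some power of π, and a ∈ I. Let Â be the π-adic completion of A, let I' = I·Â, and let a' be the image of a in Â. Then the natural A-algebra homomorphism of affine blowup algebras A[I/a] → Â[I'/a'] (induced by the canonical map A → Â) induces an isomorphism A[I/a]/π^n·A[I/a] ≅ Â[I'/a']/π^n·Â[I'/a'] for every integer n > 0; in particular, it induces an isomorphism of the π-adic completions of A[I/a] and Â[I'/a']. -/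
set_option maxHeartbeats 1000000
set_option synthInstance.maxHeartbeats 400000

/-- The affine blowup algebra `A[I/a]`: the `A`-subalgebra of the localization `A[1/a]`
generated by the elements `x/a` for `x ∈ I` (Stacks 052P). -/
noncomputable def affineBlowupAlgebra (A : Type*) [CommRing A] (I : Ideal A) (a : A) :
    Subalgebra A (Localization.Away a) :=
  Algebra.adjoin A {z : Localization.Away a | ∃ x ∈ I,
    algebraMap A (Localization.Away a) a * z = algebraMap A (Localization.Away a) x}

/-- The `π`-adic completion of a commutative ring `A`. -/
noncomputable abbrev piAdicCompletion (A : Type*) [CommRing A] (π : A) : Type _ :=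
  AdicCompletion (Ideal.span {π}) A

/-- The affine blowup algebra `Â[I·Â/a']` of the `π`-adic completion `Â` of `A`, where
`a'` is the image of `a`. -/
noncomputable abbrev affineBlowupAlgebraCompletion (A : Type*) [CommRing A] (π : A)
    (I : Ideal A) (a : A) :
    Subalgebra (piAdicCompletion A π)
      (Localization.Away (algebraMap A (piAdicCompletion A π) a)) :=
  affineBlowupAlgebra (piAdicCompletion A π) (I.map (algebraMap A (piAdicCompletion A π)))
    (algebraMap A (piAdicCompletion A π) a)

theorem mul_invSelf_pow_mem_affineBlowupAlgebra {A : Type*} [CommRing A] {I : Ideal A} {a : A}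
    {k : ℕ} {x : A} (hx : x ∈ I ^ k) :
    algebraMap A (Localization.Away a) x * IsLocalization.Away.invSelf a ^ k ∈
      affineBlowupAlgebra A I a := by
  induction k generalizing x with
  | zero => simp
  | succ k ih =>
    rw [pow_succ] at hx
    induction hx using Submodule.mul_induction_on' with
    | mem_mul_mem u hu v hv =>
      have hv' : algebraMap A (Localization.Away a) v * IsLocalization.Away.invSelf a ∈
          affineBlowupAlgebra A I a :=
        Algebra.subset_adjoin ⟨v, hv, by
          rw [mul_left_comm, IsLocalization.Away.mul_invSelf, mul_one]⟩
      convert mul_mem (ih hu) hv' using 1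
      rw [map_mul, pow_succ]
      ring
    | add u _ v _ hu hv =>
      rw [map_add, add_mul]
      exact add_mem hu hv

/-- The elements of `A[I/a]` are the fractions `x / a ^ k` with `x ∈ I ^ k`. -/
theorem mem_affineBlowupAlgebra_iff {A : Type*} [CommRing A] {I : Ideal A} {a : A} (ha : a ∈ I)
    {z : Localization.Away a} :
    z ∈ affineBlowupAlgebra A I a ↔ ∃ k : ℕ, ∃ x ∈ I ^ k,
      algebraMap A (Localization.Away a) a ^ k * z = algebraMap A (Localization.Away a) x := by
  refine ⟨fun hz ↦ ?_, ?_⟩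
  · induction hz using Algebra.adjoin_induction with
    | mem z hz =>
      obtain ⟨x, hx, h⟩ := hz
      exact ⟨1, x, by simpa using hx, by simpa using h⟩
    | algebraMap r => exact ⟨0, r, by simp, by simp⟩
    | add y z _ _ hy hz =>
      obtain ⟨k, u, hu, h₁⟩ := hy
      obtain ⟨l, v, hv, h₂⟩ := hz
      refine ⟨k + l, u * a ^ l + a ^ k * v, ?_, ?_⟩
      · rw [pow_add]
        exact add_mem (Ideal.mul_mem_mul hu (Ideal.pow_mem_pow ha l))
          (Ideal.mul_mem_mul (Ideal.pow_mem_pow ha k) hv)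
      · simp only [map_add, map_mul, map_pow, ← h₁, ← h₂]
        ring
    | mul y z _ _ hy hz =>
      obtain ⟨k, u, hu, h₁⟩ := hy
      obtain ⟨l, v, hv, h₂⟩ := hz
      refine ⟨k + l, u * v, ?_, ?_⟩
      · rw [pow_add]
        exact Ideal.mul_mem_mul hu hv
      · simp only [map_mul, ← h₁, ← h₂]
        ring
  · rintro ⟨k, x, hx, h⟩
    convert mul_invSelf_pow_mem_affineBlowupAlgebra (a := a) hx using 1
    rw [← h, mul_right_comm, ← mul_pow, IsLocalization.Away.mul_invSelf, one_pow, one_mul]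

/-- The map of affine blowup algebras induced by a ring homomorphism. -/
noncomputable def affineBlowupAlgebraMap {A C : Type*} [CommRing A] [CommRing C] (φ : A →+* C)
    {I : Ideal A} {a : A} (ha : a ∈ I) :
    affineBlowupAlgebra A I a →+* affineBlowupAlgebra C (I.map φ) (φ a) :=
  ((Localization.awayMap φ a).comp (affineBlowupAlgebra A I a).val.toRingHom).codRestrict
    (affineBlowupAlgebra C (I.map φ) (φ a)) fun z ↦ by
      obtain ⟨k, x, hx, h⟩ := (mem_affineBlowupAlgebra_iff ha).1 z.2
      refine (mem_affineBlowupAlgebra_iff (Ideal.mem_map_of_mem φ ha)).2 ⟨k, φ x, ?_, ?_⟩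
      · rw [← Ideal.map_pow]
        exact Ideal.mem_map_of_mem φ hx
      · have := congrArg (Localization.awayMap φ a) h
        simpa [Localization.awayMap, IsLocalization.Away.map, IsLocalization.map_eq] using this

theorem coe_affineBlowupAlgebraMap {A C : Type*} [CommRing A] [CommRing C] (φ : A →+* C)
    {I : Ideal A} {a : A} (ha : a ∈ I) (z : affineBlowupAlgebra A I a) :
    (affineBlowupAlgebraMap φ ha z : Localization.Away (φ a)) = Localization.awayMap φ a z :=
  rfl

theorem Localization.awayMap_algebraMap {A C : Type*} [CommRing A] [CommRing C] (φ : A →+* C)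
    (a x : A) :
    Localization.awayMap φ a (algebraMap A (Localization.Away a) x) =
      algebraMap C (Localization.Away (φ a)) (φ x) :=
  IsLocalization.map_eq _ _

theorem affineBlowupAlgebraMap_algebraMap {A C : Type*} [CommRing A] [CommRing C] (φ : A →+* C)
    {I : Ideal A} {a : A} (ha : a ∈ I) (x : A) :
    affineBlowupAlgebraMap φ ha (algebraMap A _ x) = algebraMap C _ (φ x) :=
  Subtype.ext (Localization.awayMap_algebraMap φ a x)

theorem Ideal.exists_eq_add_mul_of_mem_map {A C : Type*} [CommRing A] [CommRing C] (φ : A →+* C)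
    {c : C} (hφ : ∀ y : C, ∃ x z, y = φ x + c * z) (J : Ideal A) {y : C} (hy : y ∈ J.map φ) :
    ∃ x ∈ J, ∃ z, y = φ x + c * z := by
  induction hy using Submodule.span_induction with
  | mem y hy =>
    obtain ⟨x, hx, rfl⟩ := hy
    exact ⟨x, hx, 0, by simp⟩
  | zero => exact ⟨0, J.zero_mem, 0, by simp⟩
  | add u v _ _ hu hv =>
    obtain ⟨x, hx, z, rfl⟩ := hu
    obtain ⟨x', hx', z', rfl⟩ := hv
    exact ⟨x + x', J.add_mem hx hx', z + z', by rw [map_add]; ring⟩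
  | smul r u _ hu =>
    obtain ⟨x, hx, z, rfl⟩ := hu
    obtain ⟨s, t, rfl⟩ := hφ r
    exact ⟨s * x, J.mul_mem_left s hx, t * φ x + (φ s + c * t) * z, by
      rw [smul_eq_mul, map_mul]; ring⟩

theorem affineBlowupAlgebraMap_surjective_mod {A C : Type*} [CommRing A] [CommRing C]
    (φ : A →+* C) {π : A} (hφ : ∀ (n : ℕ) (y : C), ∃ x z, y = φ x + φ π ^ n * z)
    {I : Ideal A} {m : ℕ} (hπ : π ^ m ∈ I) {a : A} (ha : a ∈ I) (n : ℕ)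
    (y : affineBlowupAlgebra C (I.map φ) (φ a)) :
    ∃ x, y - affineBlowupAlgebraMap φ ha x ∈ Ideal.span {algebraMap C _ (φ π) ^ n} := by
  have ha' := Ideal.mem_map_of_mem φ ha
  obtain ⟨k, u, hu, h⟩ := (mem_affineBlowupAlgebra_iff ha').1 y.2
  rw [← Ideal.map_pow] at hu
  obtain ⟨x, hx, z, rfl⟩ :=
    Ideal.exists_eq_add_mul_of_mem_map φ (hφ (n + m * k)) (I ^ k) hu
  have hz : φ π ^ (m * k) * z ∈ I.map φ ^ k := by
    rw [pow_mul, ← map_pow]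
    exact Ideal.mul_mem_right _ _ (Ideal.pow_mem_pow (Ideal.mem_map_of_mem φ hπ) k)
  refine ⟨⟨_, mul_invSelf_pow_mem_affineBlowupAlgebra (a := a) hx⟩,
    Ideal.mem_span_singleton'.2 ⟨⟨_, mul_invSelf_pow_mem_affineBlowupAlgebra (a := φ a) hz⟩, ?_⟩⟩
  have hunit := IsLocalization.Away.algebraMap_pow_isUnit (S := Localization.Away (φ a)) (φ a) k
  apply Subtype.ext
  rw [← hunit.mul_right_inj]
  have hs : algebraMap C (Localization.Away (φ a)) (φ a) ^ k *
      IsLocalization.Away.invSelf (φ a) ^ k = 1 := by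
    rw [← mul_pow, IsLocalization.Away.mul_invSelf, one_pow]
  have hs' : algebraMap C (Localization.Away (φ a)) (φ a) ^ k *
      Localization.awayMap φ a (IsLocalization.Away.invSelf a ^ k) = 1 := by
    rw [← Localization.awayMap_algebraMap, ← map_pow, ← map_mul, ← mul_pow,
      IsLocalization.Away.mul_invSelf, one_pow, map_one]
  simp only [Subalgebra.coe_mul, Subalgebra.coe_sub, Subalgebra.coe_pow,
    Subalgebra.coe_algebraMap, coe_affineBlowupAlgebraMap]
  rw [mul_sub, h, map_mul (Localization.awayMap φ a), Localization.awayMap_algebraMap]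
  simp only [map_add, map_mul, map_pow, pow_add]
  simp only [map_pow] at hs'
  linear_combination
    (algebraMap C (Localization.Away (φ a)) (φ π)) ^ (m * k) * algebraMap C _ z *
      (algebraMap C (Localization.Away (φ a)) (φ π)) ^ n * hs +
      algebraMap C (Localization.Away (φ a)) (φ x) * hs'

theorem affineBlowupAlgebraMap_injective_mod {A C : Type*} [CommRing A] [CommRing C]
    (φ : A →+* C) {π : A} (hφ : ∀ (n : ℕ) (y : C), ∃ x z, y = φ x + φ π ^ n * z)
    (hφ' : ∀ (n : ℕ) (x : A), φ π ^ n ∣ φ x → π ^ n ∣ x)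
    {I : Ideal A} {m : ℕ} (hπ : π ^ m ∈ I) {a : A} (ha : a ∈ I) (n : ℕ)
    (z : affineBlowupAlgebra A I a)
    (hz : affineBlowupAlgebraMap φ ha z ∈ Ideal.span {algebraMap C _ (φ π) ^ n}) :
    z ∈ Ideal.span {algebraMap A _ π ^ n} := by
  have ha' := Ideal.mem_map_of_mem φ ha
  obtain ⟨y, hy⟩ := Ideal.mem_span_singleton'.1 hz
  obtain ⟨k, x, hx, hzx⟩ := (mem_affineBlowupAlgebra_iff ha).1 z.2
  obtain ⟨l, u, hu, hyu⟩ := (mem_affineBlowupAlgebra_iff ha').1 y.2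
  have hy' := congrArg Subtype.val hy
  simp only [Subalgebra.coe_mul, Subalgebra.coe_pow, Subalgebra.coe_algebraMap,
    coe_affineBlowupAlgebraMap] at hy'
  have hzx' := congrArg (Localization.awayMap φ a) hzx
  simp only [map_mul, map_pow, Localization.awayMap_algebraMap] at hzx'
  have key : algebraMap C (Localization.Away (φ a)) (φ a ^ l * φ x) =
      algebraMap C (Localization.Away (φ a)) (φ a ^ k * (φ π ^ n * u)) := by
    simp only [map_mul, map_pow, ← hzx', ← hyu, ← hy']
    ring
  obtain ⟨j, hj⟩ := IsLocalization.Away.exists_of_eq (φ a) key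
  set N := j + k + l with hN
  have hw : φ a ^ (j + k) * u ∈ (I ^ N).map φ := by
    rw [hN, pow_add I, Ideal.map_mul, Ideal.map_pow, Ideal.map_pow]
    exact Ideal.mul_mem_mul (Ideal.pow_mem_pow ha' _) hu
  obtain ⟨w, hw, t, hwt⟩ := Ideal.exists_eq_add_mul_of_mem_map φ (hφ (m * N)) (I ^ N) hw
  have hdvd : φ π ^ (n + m * N) ∣ φ (a ^ (j + l) * x - π ^ n * w) := by
    refine ⟨t, ?_⟩
    simp only [map_sub, map_mul, map_pow]
    linear_combination hj + φ π ^ n * hwt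
  obtain ⟨s, hs⟩ := hφ' _ _ hdvd
  have hv : w + π ^ (m * N) * s ∈ I ^ N := by
    refine add_mem hw (Ideal.mul_mem_right _ _ ?_)
    rw [pow_mul]
    exact Ideal.pow_mem_pow hπ N
  refine Ideal.mem_span_singleton'.2
    ⟨⟨_, mul_invSelf_pow_mem_affineBlowupAlgebra (a := a) hv⟩, Subtype.ext ?_⟩
  have hunit := IsLocalization.Away.algebraMap_pow_isUnit (S := Localization.Away a) a N
  have hs' : algebraMap A (Localization.Away a) a ^ N * IsLocalization.Away.invSelf a ^ N = 1 := by
    rw [← mul_pow, IsLocalization.Away.mul_invSelf, one_pow]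
  rw [← hunit.mul_right_inj]
  simp only [Subalgebra.coe_mul, Subalgebra.coe_pow, Subalgebra.coe_algebraMap]
  have hs'' := congrArg (algebraMap A (Localization.Away a)) hs
  simp only [map_add, map_sub, map_mul, map_pow] at hs'' ⊢
  have hN' : algebraMap A (Localization.Away a) a ^ N =
      algebraMap A (Localization.Away a) a ^ (j + l) * algebraMap A (Localization.Away a) a ^ k := by
    rw [hN, ← pow_add]
    ring
  linear_combination (algebraMap A (Localization.Away a) π ^ n) *
    (algebraMap A (Localization.Away a) w + algebraMap A (Localization.Away a) π ^ (m * N) *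
      algebraMap A (Localization.Away a) s) * hs' - hs'' -
      algebraMap A (Localization.Away a) a ^ (j + l) * hzx - (z : Localization.Away a) * hN'

theorem AdicCompletion.factorPow_evalₐ {T : Type*} [CommRing T] (K : Ideal T) {m n : ℕ}
    (h : m ≤ n) (x : AdicCompletion K T) :
    Ideal.Quotient.factorPow K h (AdicCompletion.evalₐ K n x) = AdicCompletion.evalₐ K m x := by
  induction x using AdicCompletion.induction_on with
  | _ x =>
    rw [AdicCompletion.evalₐ_mk, AdicCompletion.evalₐ_mk]
    exact AdicCompletion.Ideal.mk_eq_mk K h x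

/-- A compatible family of ring homomorphisms `R / I ^ n → S / J ^ n` induces a ring homomorphism
of adic completions. -/
noncomputable def AdicCompletion.ringHomOfQuotients {R S : Type*} [CommRing R] [CommRing S]
    (I : Ideal R) (J : Ideal S) (f : ∀ n, R ⧸ I ^ n →+* S ⧸ J ^ n)
    (hf : ∀ {m n : ℕ} (h : m ≤ n) (x : R ⧸ I ^ n),
      Ideal.Quotient.factorPow J h (f n x) = f m (Ideal.Quotient.factorPow I h x)) :
    AdicCompletion I R →+* AdicCompletion J S :=
  AdicCompletion.liftRingHom J (fun n ↦ (f n).comp (AdicCompletion.evalₐ I n).toRingHom) fun h ↦ by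
    ext x
    simp [hf, AdicCompletion.factorPow_evalₐ]

theorem AdicCompletion.evalₐ_ringHomOfQuotients {R S : Type*} [CommRing R] [CommRing S]
    (I : Ideal R) (J : Ideal S) (f : ∀ n, R ⧸ I ^ n →+* S ⧸ J ^ n)
    (hf : ∀ {m n : ℕ} (h : m ≤ n) (x : R ⧸ I ^ n),
      Ideal.Quotient.factorPow J h (f n x) = f m (Ideal.Quotient.factorPow I h x))
    (n : ℕ) (x : AdicCompletion I R) :
    AdicCompletion.evalₐ J n (AdicCompletion.ringHomOfQuotients I J f hf x) =
      f n (AdicCompletion.evalₐ I n x) := by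
  refine AdicCompletion.evalₐ_liftRingHom J
    (fun n ↦ (f n).comp (AdicCompletion.evalₐ I n).toRingHom) (fun h ↦ ?_) n x
  ext x
  simp [hf, AdicCompletion.factorPow_evalₐ]

/-- A compatible family of isomorphisms `R / I ^ n ≃ S / J ^ n` induces an isomorphism of
adic completions. -/
noncomputable def AdicCompletion.ringEquivOfQuotients {R S : Type*} [CommRing R] [CommRing S]
    (I : Ideal R) (J : Ideal S) (e : ∀ n, R ⧸ I ^ n ≃+* S ⧸ J ^ n)
    (he : ∀ {m n : ℕ} (h : m ≤ n) (x : R ⧸ I ^ n),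
      Ideal.Quotient.factorPow J h (e n x) = e m (Ideal.Quotient.factorPow I h x)) :
    AdicCompletion I R ≃+* AdicCompletion J S :=
  RingEquiv.ofRingHom
    (AdicCompletion.ringHomOfQuotients I J (fun n ↦ (e n : R ⧸ I ^ n →+* S ⧸ J ^ n)) he)
    (AdicCompletion.ringHomOfQuotients J I (fun n ↦ ((e n).symm : S ⧸ J ^ n →+* R ⧸ I ^ n))
      fun {m n} h x ↦ (e m).injective (by simp [← he]))
    (RingHom.ext fun x ↦ AdicCompletion.ext_evalₐ fun n ↦ by
      rw [RingHom.comp_apply, AdicCompletion.evalₐ_ringHomOfQuotients _ _ _ he,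
        AdicCompletion.evalₐ_ringHomOfQuotients]
      exact (e n).apply_symm_apply _)
    (RingHom.ext fun x ↦ AdicCompletion.ext_evalₐ fun n ↦ by
      rw [RingHom.comp_apply, AdicCompletion.evalₐ_ringHomOfQuotients,
        AdicCompletion.evalₐ_ringHomOfQuotients _ _ _ he]
      exact (e n).symm_apply_apply _)

theorem AdicCompletion.evalₐ_ringEquivOfQuotients {R S : Type*} [CommRing R] [CommRing S]
    (I : Ideal R) (J : Ideal S) (e : ∀ n, R ⧸ I ^ n ≃+* S ⧸ J ^ n)
    (he : ∀ {m n : ℕ} (h : m ≤ n) (x : R ⧸ I ^ n),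
      Ideal.Quotient.factorPow J h (e n x) = e m (Ideal.Quotient.factorPow I h x))
    (n : ℕ) (x : AdicCompletion I R) :
    AdicCompletion.evalₐ J n (AdicCompletion.ringEquivOfQuotients I J e he x) =
      e n (AdicCompletion.evalₐ I n x) :=
  AdicCompletion.evalₐ_ringHomOfQuotients I J (fun n ↦ (e n : R ⧸ I ^ n →+* S ⧸ J ^ n)) he n x

theorem AdicCompletion.exists_ringEquiv {R S : Type*} [CommRing R] [CommRing S]
    (f : R →+* S) (I : Ideal R) (J : Ideal S) (hIJ : ∀ n, I ^ n = (J ^ n).comap f)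
    (hsurj : ∀ (n : ℕ) (y : S), ∃ x, y - f x ∈ J ^ n) :
    ∃ e : AdicCompletion I R ≃+* AdicCompletion J S,
      ∀ x, e (algebraMap R _ x) = algebraMap S _ (f x) := by
  let e (n : ℕ) : R ⧸ I ^ n ≃+* S ⧸ J ^ n :=
    RingEquiv.ofBijective (Ideal.quotientMap (J ^ n) f (hIJ n).le)
      ⟨Ideal.quotientMap_injective' (hIJ n).ge, fun y ↦ by
        obtain ⟨y, rfl⟩ := Ideal.Quotient.mk_surjective y
        obtain ⟨x, hx⟩ := hsurj n y
        exact ⟨Ideal.Quotient.mk _ x, ((Ideal.Quotient.eq).2 hx).symm⟩⟩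
  refine ⟨AdicCompletion.ringEquivOfQuotients I J e fun h x ↦ ?_, fun x ↦ ?_⟩
  · obtain ⟨x, rfl⟩ := Ideal.Quotient.mk_surjective x
    rfl
  · refine AdicCompletion.ext_evalₐ fun n ↦ ?_
    rw [AdicCompletion.evalₐ_ringEquivOfQuotients, AlgHom.commutes, AlgHom.commutes]
    rfl

theorem AdicCompletion.exists_eq_algebraMap_add_pow_mul {A : Type*} [CommRing A] (π : A) (n : ℕ)
    (y : AdicCompletion (Ideal.span {π}) A) :
    ∃ x z, y = algebraMap A _ x + algebraMap A _ π ^ n * z := by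
  obtain ⟨x, hx⟩ := Ideal.Quotient.mk_surjective (AdicCompletion.evalₐ (Ideal.span {π}) n y)
  have hy : y - algebraMap A _ x ∈ (AdicCompletion.eval (Ideal.span {π}) A n).ker := by
    have h : AdicCompletion.evalₐ (Ideal.span {π}) n (y - algebraMap A _ x) = 0 := by
      rw [map_sub, AlgHom.commutes, ← hx, Ideal.Quotient.algebraMap_eq, sub_self]
    have h' := AdicCompletion.factor_evalₐ_eq_eval (Ideal.span {π})
      (y - algebraMap A _ x) (Ideal.mul_top (Ideal.span {π} ^ n)).ge
    rw [h] at h'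
    exact h'.symm.trans (_root_.map_zero (Ideal.Quotient.factor _))
  rw [← AdicCompletion.pow_smul_top_eq_ker_eval (I := Ideal.span {π}) (M := A)
      ⟨{π}, by simp⟩,
    Ideal.span_singleton_pow, Submodule.ideal_span_singleton_smul] at hy
  obtain ⟨z, -, hz⟩ := hy
  refine ⟨x, z, ?_⟩
  rw [← map_pow, ← Algebra.smul_def]
  exact eq_add_of_sub_eq' hz.symm

theorem AdicCompletion.pow_dvd_of_algebraMap_pow_dvd {A : Type*} [CommRing A] (π : A) (n : ℕ)
    (x : A) (h : algebraMap A (AdicCompletion (Ideal.span {π}) A) π ^ n ∣ algebraMap A _ x) :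
    π ^ n ∣ x := by
  have h' := map_dvd (AdicCompletion.evalₐ (Ideal.span {π}) n) h
  rw [map_pow, AlgHom.commutes, AlgHom.commutes, ← map_pow, Ideal.Quotient.algebraMap_eq,
    Ideal.Quotient.eq_zero_iff_mem.2 (Ideal.pow_mem_pow (Ideal.mem_span_singleton_self π) n),
    zero_dvd_iff, Ideal.Quotient.eq_zero_iff_mem, Ideal.span_singleton_pow,
    Ideal.mem_span_singleton] at h'
  exact h'

/-- Let `A` be a commutative ring, `π ∈ A`, `I` an ideal of `A` containing a
power of `π`, and `a ∈ I`. Let `Â` be the `π`-adic completion of `A`, `I' = I·Â` and `a'` the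
image of `a` in `Â`. Then the natural `A`-algebra homomorphism `A[I/a] → Â[I'/a']` of affine
blowup algebras induces an isomorphism `A[I/a]/π^n ≅ Â[I'/a']/π'^n` for every `n > 0`; in
particular it induces an isomorphism of the `π`-adic completions. -/
theorem statement12 {A : Type} [CommRing A] (π : A) (I : Ideal A)
    (hπI : ∃ m : ℕ, π ^ m ∈ I) (a : A) (ha : a ∈ I) :
    ∃ g : affineBlowupAlgebra A I a →+* affineBlowupAlgebraCompletion A π I a,
      -- `g` is the natural `A`-algebra homomorphism
      (∀ x : A,
        g (algebraMap A (affineBlowupAlgebra A I a) x) =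
          algebraMap (piAdicCompletion A π) (affineBlowupAlgebraCompletion A π I a)
            (algebraMap A (piAdicCompletion A π) x)) ∧
      -- `g` induces an isomorphism modulo `π^n` for every `n > 0`
      (∀ n : ℕ, 0 < n →
        (∀ x : affineBlowupAlgebra A I a,
          g x ∈ Ideal.span {algebraMap (piAdicCompletion A π)
              (affineBlowupAlgebraCompletion A π I a)
              (algebraMap A (piAdicCompletion A π) π) ^ n} →
          x ∈ Ideal.span {algebraMap A (affineBlowupAlgebra A I a) π ^ n}) ∧
        (∀ y : affineBlowupAlgebraCompletion A π I a,
          ∃ x : affineBlowupAlgebra A I a,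
            y - g x ∈ Ideal.span {algebraMap (piAdicCompletion A π)
              (affineBlowupAlgebraCompletion A π I a)
              (algebraMap A (piAdicCompletion A π) π) ^ n})) ∧
      -- in particular, `g` induces an isomorphism of the `π`-adic completions
      ∃ e : AdicCompletion (Ideal.span {algebraMap A (affineBlowupAlgebra A I a) π})
              (affineBlowupAlgebra A I a) ≃+*
            AdicCompletion (Ideal.span {algebraMap (piAdicCompletion A π)
                (affineBlowupAlgebraCompletion A π I a)
                (algebraMap A (piAdicCompletion A π) π)})
              (affineBlowupAlgebraCompletion A π I a),
        ∀ x : affineBlowupAlgebra A I a,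
          e (algebraMap (affineBlowupAlgebra A I a)
              (AdicCompletion (Ideal.span {algebraMap A (affineBlowupAlgebra A I a) π})
                (affineBlowupAlgebra A I a)) x) =
            algebraMap (affineBlowupAlgebraCompletion A π I a)
              (AdicCompletion (Ideal.span {algebraMap (piAdicCompletion A π)
                  (affineBlowupAlgebraCompletion A π I a)
                  (algebraMap A (piAdicCompletion A π) π)})
                (affineBlowupAlgebraCompletion A π I a)) (g x) := by
  obtain ⟨m, hm⟩ := hπI
  have hφ := AdicCompletion.exists_eq_algebraMap_add_pow_mul π
  have hinj := affineBlowupAlgebraMap_injective_mod _ hφ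
    (AdicCompletion.pow_dvd_of_algebraMap_pow_dvd π) hm ha
  have hsurj := affineBlowupAlgebraMap_surjective_mod _ hφ hm ha
  refine ⟨affineBlowupAlgebraMap (algebraMap A (piAdicCompletion A π)) ha,
    affineBlowupAlgebraMap_algebraMap _ ha, fun n _ ↦ ⟨hinj n, hsurj n⟩,
    AdicCompletion.exists_ringEquiv _ _ _ (fun n ↦ ?_) fun n y ↦ ?_⟩
  · rw [Ideal.span_singleton_pow, Ideal.span_singleton_pow]
    refine le_antisymm ?_ (hinj n)
    rw [Ideal.span_singleton_le_iff_mem, Ideal.mem_comap, map_pow,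
      affineBlowupAlgebraMap_algebraMap]
    exact Ideal.mem_span_singleton_self _
  · rw [Ideal.span_singleton_pow]
    exact hsurj n y
end

section
/- Let A be a commutative ring, π ∈ A, and B an A-subalgebra of the localization A[1/π]. Assume that for some n ∈ ℕ the induced homomorphism Â → B̂ of π-adic completions is a π^n-isomorphism. Then π^n·b lies in the image of A in B for every b ∈ B; that is, π^n annihilates the cokernel of A → B. -/
/-- Let `A` be a commutative ring, `π ∈ A`, and `B` an `A`-subalgebra of the
localization `A[1/π]`. Assume that for some `n ∈ ℕ` the induced homomorphism `Â → B̂` of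
`π`-adic completions is a `π^n`-isomorphism (kernel and cokernel annihilated by `π^n`). Then
`π^n · b` lies in the image of `A` in `B` for every `b ∈ B`; that is, `π^n` annihilates the
cokernel of `A → B`. -/
theorem statement13 {A : Type*} [CommRing A] (π : A)
    (B : Subalgebra A (Localization.Away π)) (n : ℕ)
    (hker : ∀ x : AdicCompletion (Ideal.span {π}) A,
      AdicCompletion.map (Ideal.span {π}) (Algebra.linearMap A B) x = 0 → π ^ n • x = 0)
    (hcoker : ∀ y : AdicCompletion (Ideal.span {π}) B,
      ∃ x : AdicCompletion (Ideal.span {π}) A,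
        π ^ n • y = AdicCompletion.map (Ideal.span {π}) (Algebra.linearMap A B) x) :
    ∀ b : B, ∃ a : A, π ^ n • b = algebraMap A B a := by
  intro b
  obtain ⟨a, k, hk⟩ : ∃ (a : A) (k : ℕ), algebraMap A B a = π ^ k • b := by
    obtain ⟨k, a, h⟩ := IsLocalization.Away.surj π (b : Localization.Away π)
    refine ⟨a, k, Subtype.ext ?_⟩
    rw [Subalgebra.coe_smul, Algebra.smul_def, map_pow, mul_comm, h, Subalgebra.coe_algebraMap]
  obtain ⟨x, hx⟩ := hcoker (AdicCompletion.of _ B b)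
  have hzero : π ^ n • (π ^ k • x - AdicCompletion.of (Ideal.span {π}) A (π ^ n * a)) = 0 := by
    apply hker
    rw [map_sub, LinearMap.map_smul_of_tower, ← hx, AdicCompletion.map_of,
      Algebra.linearMap_apply, map_mul, hk, ← Algebra.smul_def, map_smul, map_smul,
      smul_comm, sub_self]
  obtain ⟨c, hc⟩ := Submodule.mkQ_surjective _ (AdicCompletion.eval (Ideal.span {π}) A (n + k) x)
  have hmem : π ^ n * (π ^ k * c - π ^ n * a) ∈ Ideal.span {π} ^ (n + k) := by
    have h := congrArg (AdicCompletion.eval (Ideal.span {π}) A (n + k)) hzero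
    rw [map_smul, map_sub, map_smul, AdicCompletion.eval_of, ← hc, ← map_smul, ← map_sub,
      ← map_smul, map_zero, Submodule.mkQ_apply, Submodule.Quotient.mk_eq_zero] at h
    simpa only [smul_eq_mul, Ideal.mul_top] using h
  rw [Ideal.span_singleton_pow, Ideal.mem_span_singleton] at hmem
  obtain ⟨d, hd⟩ := hmem
  refine ⟨c - d, Subtype.ext ?_⟩
  have hu : IsUnit (algebraMap A (Localization.Away π) π ^ (n + k)) :=
    (IsLocalization.Away.algebraMap_isUnit π).pow _
  have hd' := congrArg (algebraMap A (Localization.Away π)) hd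
  have hk' := congrArg (Subtype.val : B → Localization.Away π) hk
  rw [Subalgebra.coe_smul, Subalgebra.coe_algebraMap, Algebra.smul_def] at hk'
  rw [Subalgebra.coe_smul, Subalgebra.coe_algebraMap, Algebra.smul_def]
  apply hu.mul_left_cancel
  simp only [map_mul, map_sub, map_pow] at hd' hk' ⊢
  rw [hk'] at hd'
  linear_combination -hd'
end

section
/- Let R be a commutative ring, M a finite free R-module of rank n, and φ an R-linear endomorphism of M. Then, in the polynomial ring R[X], one has det(id − X·φ_X) = Σ_{k=0}^{n} (−1)^k Tr(⋀^k φ)·X^k, where φ_X denotes the base change of φ to an R[X]-linear endomorphism of R[X] ⊗_R M, ⋀^k φ denotes the R-linear endomorphism induced by φ on the k-th exterior power ⋀^k M, and Tr denotes the trace. -/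
open TensorProduct

/-- The trace of the endomorphism induced by `f` on the `k`-th exterior power is the sum of the
`k × k` principal minors of the matrix of `f` in a basis. -/
theorem exteriorPower.trace_map_eq_sum_minors {R M I : Type*} [CommRing R] [AddCommGroup M]
    [Module R M] [LinearOrder I] [Fintype I] (b : Module.Basis I R M) (k : ℕ) (f : M →ₗ[R] M) :
    LinearMap.trace R (⋀[R]^k M) (exteriorPower.map k f) =
      ∑ s ∈ Finset.univ.powersetCard k,
        ((LinearMap.toMatrix b b f).submatrix (Subtype.val : s → I) (Subtype.val : s → I)).det := by
  rw [LinearMap.trace_eq_matrix_trace R (b.exteriorPower k), Matrix.trace]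
  symm
  refine (Finset.sum_subtype (F := inferInstance) _ (p := fun s => s ∈ Set.powersetCard I k) (fun s => by simp) _).trans ?_
  refine Finset.sum_congr (by ext; simp) fun s _ => ?_
  rw [Matrix.diag_apply, LinearMap.toMatrix_apply, exteriorPower.basis_repr_apply,
    exteriorPower.basis_apply, exteriorPower.map_apply_ιMulti_family, exteriorPower.ιMulti_family,
    exteriorPower.ιMultiDual_apply_ιMulti, ← Matrix.det_transpose,
    ← Matrix.det_submatrix_equiv_self (s.1.orderIsoOfFin s.2).toEquiv]
  congr 1
  ext i j
  simp [LinearMap.toMatrix_apply, Set.powersetCard.ofFinEmbEquiv_symm_apply]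
  rfl

/-- `det (1 - X • A)` is the alternating generating polynomial of the sums of principal minors. -/
theorem Matrix.charpolyRev_eq_sum_minors {R I : Type*} [CommRing R] [Fintype I] [DecidableEq I]
    (A : Matrix I I R) :
    A.charpolyRev = ∑ k ∈ Finset.range (Fintype.card I + 1),
      (-1 : Polynomial R) ^ k * Polynomial.C (∑ s ∈ Finset.univ.powersetCard k,
        (A.submatrix (Subtype.val : s → I) (Subtype.val : s → I)).det) * Polynomial.X ^ k := by
  have hrev : A.charpolyRev = (1 + (Polynomial.X : Polynomial R) • (-A).map Polynomial.C).det := by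
    rw [Matrix.charpolyRev, sub_eq_add_neg, Matrix.map_neg Polynomial.C (map_neg Polynomial.C) A,
      smul_neg]
  ext m
  have hsign (k : ℕ) : (-1 : Polynomial R) ^ k = Polynomial.C ((-1) ^ k) := by simp
  simp_rw [hsign, ← Polynomial.C_mul, Polynomial.finsetSum_coeff, Polynomial.coeff_C_mul_X_pow]
  rw [hrev, Matrix.coeff_det_one_add_X_smul_eq_sum_minors, Finset.sum_ite_eq, Finset.mul_sum]
  split_ifs with hm
  · refine Finset.sum_congr rfl fun s hs => ?_
    rw [Matrix.submatrix_neg, Pi.neg_apply, Pi.neg_apply, Matrix.det_neg, Fintype.card_coe,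
      (Finset.mem_powersetCard.mp hs).2]
  · rw [Finset.powersetCard_eq_empty.mpr, Finset.sum_empty]
    simpa using hm

/-- Let `R` be a commutative ring, `M` a finite free `R`-module of rank `n`,
and `φ` an `R`-linear endomorphism of `M`. Then, in `R[X]`, the reverse characteristic
polynomial satisfies `det(id − X·φ_X) = Σ_{k=0}^{n} (−1)^k Tr(⋀^k φ)·X^k`, where `φ_X` is the
base change of `φ` to `R[X] ⊗_R M` and `⋀^k φ` (here any endomorphism `ψ k` of the `k`-th
exterior power compatible with the map induced by `φ` on the exterior algebra) is the
endomorphism functorially induced by `φ` on `⋀[R]^k M`. -/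
theorem statement18 {R M : Type*} [CommRing R] [AddCommGroup M] [Module R M]
    [Module.Free R M] [Module.Finite R M] (n : ℕ) (hrank : Module.finrank R M = n)
    (φ : M →ₗ[R] M)
    (ψ : ∀ k : ℕ, ↥(ExteriorAlgebra.exteriorPower R k M) →ₗ[R] ↥(ExteriorAlgebra.exteriorPower R k M))
    (hψ : ∀ (k : ℕ) (x : ExteriorAlgebra.exteriorPower R k M),
      (↑(ψ k x) : ExteriorAlgebra R M) = ExteriorAlgebra.map φ (↑x : ExteriorAlgebra R M)) :
    LinearMap.det (LinearMap.id - (Polynomial.X : Polynomial R) •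
        LinearMap.baseChange (Polynomial R) φ) =
      ∑ k ∈ Finset.range (n + 1),
        (-1 : Polynomial R) ^ k *
          Polynomial.C (LinearMap.trace R (ExteriorAlgebra.exteriorPower R k M) (ψ k)) * Polynomial.X ^ k := by
  nontriviality R
  let b := Module.finBasisOfFinrankEq R M hrank
  have hψ_map (k : ℕ) : ψ k = exteriorPower.map k φ := by
    refine exteriorPower.linearMap_ext (AlternatingMap.ext fun v => Subtype.ext ?_)
    simp [hψ, ExteriorAlgebra.map_apply_ιMulti, Function.comp_def]
  have hdet : LinearMap.det (LinearMap.id - (Polynomial.X : Polynomial R) •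
      LinearMap.baseChange (Polynomial R) φ) = (LinearMap.toMatrix b b φ).charpolyRev := by
    rw [← LinearMap.det_toMatrix (b.baseChange (Polynomial R)), Matrix.charpolyRev]
    congr 1
    ext1 i j
    simp [LinearMap.toMatrix_apply, Matrix.one_apply, Finsupp.single_apply, eq_comm,
      Polynomial.smul_eq_C_mul]
  rw [hdet, Matrix.charpolyRev_eq_sum_minors, Fintype.card_fin]
  simp_rw [hψ_map, exteriorPower.trace_map_eq_sum_minors b]
end

section
/- Let p be a prime number, V a Banach space over ℚ_p, d ∈ ℕ, and (v_m)_{m ∈ ℕ^d} a family of elements of V such that ‖v_m‖ tends to 0 along the cofinite filter on ℕ^d. Assume that for every (a_1, …, a_d) ∈ ℤ_p^d the family (a_1^{m_1}···a_d^{m_d}·v_m)_{m ∈ ℕ^d} is summable in V with sum 0. Then v_m = 0 for every m ∈ ℕ^d. -/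
/-- A power series over `ℚ_[p]` that converges to zero at every point of `ℤ_[p]` has zero
coefficients. -/
theorem coeff_eq_zero_of_hasSum_padicInt (p : ℕ) [Fact p.Prime] {V : Type*}
    [NormedAddCommGroup V] [NormedSpace ℚ_[p] V] (w : ℕ → V)
    (h : ∀ a : ℤ_[p], HasSum (fun k : ℕ => ((a : ℚ_[p]) ^ k) • w k) 0) (k : ℕ) : w k = 0 := by
  let q : FormalMultilinearSeries ℚ_[p] ℚ_[p] V := fun n =>
    ContinuousMultilinearMap.mkPiRing ℚ_[p] (Fin n) (w n)
  have hnorm (n : ℕ) : ‖q n‖ = ‖w n‖ := ContinuousMultilinearMap.norm_mkPiRing (w n)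
  have hq : HasFPowerSeriesOnBall (0 : ℚ_[p] → V) q 0 1 := by
    refine ⟨?_, one_pos, ?_⟩
    · have hw : Filter.Tendsto (fun n => ‖q n‖ * ((1 : NNReal) : ℝ) ^ n) Filter.atTop (nhds 0) := by
        simpa [hnorm] using (h 1).summable.tendsto_atTop_zero.norm
      exact_mod_cast q.le_radius_of_tendsto hw
    · intro y hy
      have hy' : ‖y‖ < 1 := by simpa [← ofReal_norm] using hy
      simpa [q, ContinuousMultilinearMap.mkPiRing_apply] using h ⟨y, hy'.le⟩
  have hk : q k = 0 := by rw [hq.hasFPowerSeriesAt.eq_zero]; rfl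
  rw [← norm_eq_zero, ← hnorm, hk, norm_zero]

/-- A multivariate power series over `ℚ_[p]` that converges to zero at every point of `ℤ_[p] ^ d`
has zero coefficients. -/
theorem coeff_eq_zero_of_hasSum_padicInt_pi (p : ℕ) [Fact p.Prime] {V : Type*}
    [NormedAddCommGroup V] [NormedSpace ℚ_[p] V] [CompleteSpace V] (d : ℕ)
    (v : (Fin d → ℕ) → V)
    (h : ∀ a : Fin d → ℤ_[p],
      HasSum (fun m : Fin d → ℕ => (∏ i, ((a i : ℚ_[p]) ^ m i)) • v m) 0)
    (m : Fin d → ℕ) : v m = 0 := by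
  induction d with
  | zero =>
    have h0 := (h 0).unique (hasSum_unique _)
    rw [Finset.univ_eq_empty, Finset.prod_empty, one_smul] at h0
    exact (congrArg v (Subsingleton.elim _ _)).trans h0.symm
  | succ d ih =>
    have hcons (a : ℤ_[p]) (b : Fin d → ℤ_[p]) :
        HasSum (fun x : ℕ × (Fin d → ℕ) =>
          ((a : ℚ_[p]) ^ x.1) • (∏ i, ((b i : ℚ_[p]) ^ x.2 i)) • v (Fin.cons x.1 x.2)) 0 := by
      have := (Fin.consEquiv fun _ : Fin (d + 1) => ℕ).hasSum_iff.mpr (h (Fin.cons a b))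
      simpa [Function.comp_def, Fin.consEquiv, Fin.prod_univ_succ, mul_smul] using this
    have hfiber (b : Fin d → ℤ_[p]) (k : ℕ) :
        Summable fun n : Fin d → ℕ => (∏ i, ((b i : ℚ_[p]) ^ n i)) • v (Fin.cons k n) := by
      simpa using (hcons 1 b).summable.prod_factor k
    have hzero (b : Fin d → ℤ_[p]) (k : ℕ) :
        ∑' n : Fin d → ℕ, (∏ i, ((b i : ℚ_[p]) ^ n i)) • v (Fin.cons k n) = 0 :=
      coeff_eq_zero_of_hasSum_padicInt p _ (fun a => (hcons a b).prod_fiberwise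
        fun k => (hfiber b k).hasSum.const_smul _) k
    rw [← Fin.cons_self_tail m]
    exact ih (fun n => v (Fin.cons (m 0) n))
      (fun b => hzero b (m 0) ▸ (hfiber b (m 0)).hasSum) (Fin.tail m)


/-- Let `p` be a prime, `V` a Banach space over `ℚ_p`, `d ∈ ℕ`, and
`(v_m)_{m ∈ ℕ^d}` a family of elements of `V` such that `‖v m‖ → 0` along the cofinite filter
on `ℕ^d`. Assume that for every `(a_1, …, a_d) ∈ ℤ_p^d` the family
`(a_1^{m_1} ⋯ a_d^{m_d} • v_m)_m` is summable in `V` with sum `0`. Then `v_m = 0` for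
every `m`. -/
theorem statement19 (p : ℕ) [Fact p.Prime] {V : Type*} [NormedAddCommGroup V]
    [NormedSpace ℚ_[p] V] [CompleteSpace V] (d : ℕ) (v : (Fin d → ℕ) → V)
    (hv : Filter.Tendsto (fun m => ‖v m‖) Filter.cofinite (nhds 0))
    (hsum : ∀ a : Fin d → ℤ_[p],
      HasSum (fun m : Fin d → ℕ => (∏ i, ((a i : ℚ_[p]) ^ m i)) • v m) 0) :
    ∀ m, v m = 0 := by
  exact coeff_eq_zero_of_hasSum_padicInt_pi p d v hsum
end
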